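/- Let (X,d,m) be a PI space. Then: (i) if a set E ⊆ X of finite perimeter has the property that every f ∈ L¹_loc(m) with |Df|(X) < +∞ and |Df|(E^1) = 0 is m-a.e. equal to a constant on E, then E is indecomposable; (ii) if moreover (X,d,m) is isotropic and satisfies property (1.2), then every indecomposable set E ⊆ X of finite perimeter has that property: every f ∈ L¹_loc(m) with |Df|(X) < +∞ and |Df|(E^1) = 0 is m-a.e. equal to a constant on E. -/

import Mathlib

open MeasureTheory Metric Filter Set
open scoped ENNReal NNReal Topology

namespace PaperBV

noncomputable section

variable {X : Type*} [MetricSpace X]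

/-- `f` is locally Lipschitz on `Ω`. -/
def LocLipOn (Ω : Set X) (f : X → ℝ) : Prop :=
  ∀ x ∈ Ω, ∃ K : ℝ≥0, ∃ t ∈ 𝓝[Ω] x, LipschitzOnWith K f t

/-- The local Lipschitz constant (slope) `lip f` of a function, with value `0` at
points that are not accumulation points (there the filter `𝓝[≠] x` is trivial). -/
def lipConst (f : X → ℝ) (x : X) : ℝ≥0∞ :=
  Filter.limsup (fun y => ENNReal.ofReal (|f y - f x| / dist y x)) (𝓝[≠] x)

variable [MeasurableSpace X]

/-- Convergence `fn → f` in `L¹_loc(μ⌊Ω)`. -/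
def TendstoL1loc (μ : Measure X) (Ω : Set X) (fn : ℕ → X → ℝ) (f : X → ℝ) : Prop :=
  ∀ K : Set X, IsCompact K → K ⊆ Ω →
    Filter.Tendsto (fun n => ∫⁻ x in K, ENNReal.ofReal |fn n x - f x| ∂μ)
      Filter.atTop (𝓝 0)

/-- The total variation `|Df|(Ω)` of `f` on an open set `Ω`, defined by relaxation of the
integral of the local Lipschitz constant along locally Lipschitz approximations. -/
def tvOpen (μ : Measure X) (f : X → ℝ) (Ω : Set X) : ℝ≥0∞ :=
  sInf { a : ℝ≥0∞ | ∃ fn : ℕ → X → ℝ, (∀ n, LocLipOn Ω (fn n)) ∧ TendstoL1loc μ Ω fn f ∧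
    a = Filter.liminf (fun n => ∫⁻ x in Ω, lipConst (fn n) x ∂μ) Filter.atTop }

/-- The total variation measure `|Df|(B)` of `f` on an arbitrary set, obtained from the
values on open sets by the Carathéodory construction. -/
def tv (μ : Measure X) (f : X → ℝ) (B : Set X) : ℝ≥0∞ :=
  ⨅ (Ω : Set X) (_ : IsOpen Ω) (_ : B ⊆ Ω), tvOpen μ f Ω

/-- `f` is a function of bounded variation: `f ∈ L¹(μ)` and `|Df|(X) < ∞`. -/
def BVFun (μ : Measure X) (f : X → ℝ) : Prop :=
  MeasureTheory.Integrable f μ ∧ tv μ f Set.univ < ⊤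

/-- The perimeter `P(E, B) = |D 1_E|(B)`. -/
def perim (μ : Measure X) (E B : Set X) : ℝ≥0∞ :=
  tv μ (E.indicator fun _ => (1 : ℝ)) B

/-- `E` is a (Borel) set of finite perimeter. -/
def FinPerim (μ : Measure X) (E : Set X) : Prop :=
  MeasurableSet E ∧ perim μ E Set.univ < ⊤

/-- `μ` is a doubling measure with doubling constant `CD`. -/
def Doubling (μ : Measure X) (CD : ℝ≥0) : Prop :=
  1 ≤ CD ∧ ∀ (x : X) (r : ℝ), 0 < r → μ (ball x (2 * r)) ≤ (CD : ℝ≥0∞) * μ (ball x r)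

/-- The mean value `f_{x,r}` of `f` on the ball `B_r(x)`. -/
def ballAvg (μ : Measure X) (f : X → ℝ) (x : X) (r : ℝ) : ℝ :=
  (∫ y in ball x r, f y ∂μ) / (μ (ball x r)).toReal

/-- The weak `(1,1)`-Poincaré inequality with constants `CP`, `lam`,
for locally Lipschitz functions. -/
def WeakPoincare (μ : Measure X) (CP lam : ℝ) : Prop :=
  ∀ f : X → ℝ, LocLipOn Set.univ f → ∀ (x : X) (r : ℝ), 0 < r →
    ∫⁻ y in ball x r, ENNReal.ofReal |f y - ballAvg μ f x r| ∂μ ≤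
      ENNReal.ofReal (CP * r) * ∫⁻ y in ball x (lam * r), lipConst f y ∂μ

/-- A PI space: doubling and supporting a weak `(1,1)`-Poincaré inequality. -/
def IsPI (μ : Measure X) : Prop :=
  ∃ (CD : ℝ≥0) (CP lam : ℝ), Doubling μ CD ∧ 0 < CP ∧ 1 ≤ lam ∧ WeakPoincare μ CP lam

/-- The pre-measure `H_δ` of the codimension-one Hausdorff measure: infimum over countable
covers by balls of radii at most `δ` of `∑ μ(B_{r_i}(x_i)) / (2 r_i)`. -/
def preH (μ : Measure X) (δ : ℝ) (S : Set X) : ℝ≥0∞ :=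
  ⨅ (c : ℕ → X × ℝ) (_ : ∀ i, 0 < (c i).2 ∧ (c i).2 ≤ δ)
    (_ : S ⊆ ⋃ i, ball (c i).1 (c i).2),
    ∑' i, μ (ball (c i).1 (c i).2) / ENNReal.ofReal (2 * (c i).2)

/-- The codimension-one Hausdorff measure `H = lim_{δ ↓ 0} H_δ = sup_{δ > 0} H_δ`
(as an outer-measure-type set function). -/
def codimH (μ : Measure X) (S : Set X) : ℝ≥0∞ :=
  ⨆ (δ : ℝ) (_ : 0 < δ), preH μ δ S

/-- The upper density of `E` at `x`. -/
def upperDens (μ : Measure X) (E : Set X) (x : X) : ℝ≥0∞ :=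
  Filter.limsup (fun r : ℝ => μ (E ∩ ball x r) / μ (ball x r)) (𝓝[>] (0 : ℝ))

/-- The essential boundary `∂^e E`. -/
def essBdry (μ : Measure X) (E : Set X) : Set X :=
  {x | 0 < upperDens μ E x ∧ 0 < upperDens μ Eᶜ x}

/-- The essential interior `E^1`: points of density `1`. -/
def essInt (μ : Measure X) (E : Set X) : Set X :=
  {x | Filter.Tendsto (fun r : ℝ => μ (E ∩ ball x r) / μ (ball x r))
    (𝓝[>] (0 : ℝ)) (𝓝 (1 : ℝ≥0∞))}

/-- Integral `∫_S f dν` with respect to an outer-measure-type set function `ν`,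
via the layer-cake formula. -/
def outerLint (ν : Set X → ℝ≥0∞) (S : Set X) (f : X → ℝ≥0∞) : ℝ≥0∞ :=
  ∫⁻ t in Set.Ioi (0 : ℝ), ν {x ∈ S | ENNReal.ofReal t < f x}

/-- `θ` is a family of densities representing the perimeter measures with respect to the
codimension-one Hausdorff measure: `P(E,B) = ∫_{B ∩ ∂^e E} θ_E dH`, with
`γ ≤ θ_E ≤ C` on `∂^e E` for structural constants `0 < γ`, `C < ∞`. -/
def PerimRepr (μ : Measure X) (θ : Set X → X → ℝ≥0∞) : Prop :=
  ∃ γ C : ℝ≥0∞, 0 < γ ∧ C ≠ ⊤ ∧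
    ∀ E : Set X, FinPerim μ E →
      (∀ x ∈ essBdry μ E, γ ≤ θ E x ∧ θ E x ≤ C) ∧
      ∀ B : Set X, MeasurableSet B →
        perim μ E B = outerLint (codimH μ) (B ∩ essBdry μ E) (θ E)

/-- The space is isotropic: the densities `θ_E` can be chosen so that, whenever `F ⊆ E` are
sets of finite perimeter, `θ_F = θ_E` holds `H`-a.e. on `∂^e F ∩ ∂^e E`. -/
def Isotropic (μ : Measure X) : Prop :=
  ∃ θ : Set X → X → ℝ≥0∞, PerimRepr μ θ ∧
    ∀ E F : Set X, FinPerim μ E → FinPerim μ F → F ⊆ E →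
      codimH μ {x ∈ essBdry μ F ∩ essBdry μ E | θ F x ≠ θ E x} = 0

/-- Property (1.2): `H(∂^e E ∩ ∂^e F ∩ ∂^e (E ∪ F)) = 0` for disjoint sets of finite
perimeter. -/
def Prop12 (μ : Measure X) : Prop :=
  ∀ E F : Set X, FinPerim μ E → FinPerim μ F → Disjoint E F →
    codimH μ (essBdry μ E ∩ essBdry μ F ∩ essBdry μ (E ∪ F)) = 0

/-- `E` is decomposable in `B`: `E ∩ B` admits a partition into two sets of finite perimeter
and positive measure such that the perimeter in `B` is additive. -/
def DecomposableIn (μ : Measure X) (E B : Set X) : Prop :=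
  ∃ F G : Set X, FinPerim μ F ∧ FinPerim μ G ∧ Disjoint F G ∧ F ∪ G = E ∩ B ∧
    0 < μ F ∧ 0 < μ G ∧ perim μ E B = perim μ F B + perim μ G B

/-- `E` is a set of finite perimeter which is indecomposable in `B`. -/
def IndecomposableIn (μ : Measure X) (E B : Set X) : Prop :=
  FinPerim μ E ∧ ¬ DecomposableIn μ E B

/-- `E` is an indecomposable set (of finite perimeter). -/
def Indecomposable (μ : Measure X) (E : Set X) : Prop :=
  IndecomposableIn μ E Set.univ

/-- `E` is a simple set. -/
def SimpleSet (μ : Measure X) (E : Set X) : Prop :=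
  FinPerim μ E ∧ μ E < ⊤ ∧
  ∀ F : Set X, FinPerim μ F → codimH μ (essBdry μ F \ essBdry μ E) = 0 →
    μ F = 0 ∨ μ Fᶜ = 0 ∨ μ (symmDiff F E) = 0 ∨ μ (symmDiff F Eᶜ) = 0

end

section Slope

variable {X : Type*} [MetricSpace X]

lemma ennreal_limsup_add_le {α : Type*} (l : Filter α) (u v : α → ℝ≥0∞) :
    limsup (fun a => u a + v a) l ≤ limsup u l + limsup v l := by
  refine ENNReal.le_of_forall_pos_le_add fun ε hε hfin => ?_
  have hu : limsup u l < ⊤ := lt_of_le_of_lt le_self_add hfin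
  have hv : limsup v l < ⊤ := lt_of_le_of_lt le_add_self hfin
  have hε2 : (ε / 2 : ℝ≥0∞) ≠ 0 := by
    simp [hε.ne']
  have h1 := eventually_lt_of_limsup_lt (ENNReal.lt_add_right hu.ne hε2)
  have h2 := eventually_lt_of_limsup_lt (ENNReal.lt_add_right hv.ne hε2)
  refine limsup_le_of_le (by isBoundedDefault) ?_
  filter_upwards [h1, h2] with a ha hb
  calc u a + v a ≤ (limsup u l + ε / 2) + (limsup v l + ε / 2) := add_le_add ha.le hb.le
    _ = limsup u l + limsup v l + ε := by
      rw [add_add_add_comm, ENNReal.add_halves]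

lemma lipConst_congr {f g : X → ℝ} {x : X} (h : f =ᶠ[𝓝 x] g) :
    lipConst f x = lipConst g x := by
  unfold lipConst
  refine limsup_congr ?_
  filter_upwards [h.filter_mono nhdsWithin_le_nhds] with y hy
  rw [hy, h.self_of_nhds]

lemma lipConst_mono_abs {f g : X → ℝ} {x : X} (h : ∀ y, |f y - f x| ≤ |g y - g x|) :
    lipConst f x ≤ lipConst g x := by
  unfold lipConst
  refine limsup_le_limsup (Eventually.of_forall fun y => ?_)
  exact ENNReal.ofReal_le_ofReal (div_le_div_of_nonneg_right (h y) dist_nonneg)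

lemma lipConst_const_sub (c : ℝ) (f : X → ℝ) (x : X) :
    lipConst (fun y => c - f y) x = lipConst f x := by
  refine le_antisymm (lipConst_mono_abs fun y => ?_) (lipConst_mono_abs fun y => ?_) <;>
  · rw [sub_sub_sub_cancel_left, abs_sub_comm]

lemma lipConst_sub_const (c : ℝ) (f : X → ℝ) (x : X) :
    lipConst (fun y => f y - c) x = lipConst f x := by
  simp [lipConst]

lemma lipConst_const (c : ℝ) (x : X) : lipConst (fun _ => c) x = 0 := by
  simpa [lipConst] using limsup_const_bot (f := 𝓝[≠] x) (α := ℝ≥0∞)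

lemma lipConst_eq_zero_of_eventuallyEq_const {f : X → ℝ} {c : ℝ} {x : X}
    (h : f =ᶠ[𝓝 x] fun _ => c) : lipConst f x = 0 := by
  rw [lipConst_congr h, lipConst_const]

lemma lipConst_le_add_of_abs_le {f g h : X → ℝ} {x : X}
    (H : ∀ y, |h y - h x| ≤ |f y - f x| + |g y - g x|) :
    lipConst h x ≤ lipConst f x + lipConst g x := by
  unfold lipConst
  refine le_trans (limsup_le_limsup (Eventually.of_forall fun y => ?_))
    (ennreal_limsup_add_le _ _ _)
  dsimp only
  rw [← ENNReal.ofReal_add (by positivity) (by positivity), ← add_div]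
  exact ENNReal.ofReal_le_ofReal (div_le_div_of_nonneg_right (H y) dist_nonneg)

lemma lipConst_add_le (f g : X → ℝ) (x : X) :
    lipConst (fun y => f y + g y) x ≤ lipConst f x + lipConst g x :=
  lipConst_le_add_of_abs_le fun y => by
    rw [add_sub_add_comm]; exact abs_add_le _ _

lemma lipConst_sum_le {ι : Type*} (s : Finset ι) (f : ι → X → ℝ) (x : X) :
    lipConst (fun y => ∑ i ∈ s, f i y) x ≤ ∑ i ∈ s, lipConst (f i) x := by
  classical
  induction s using Finset.induction_on with
  | empty => simp [lipConst_const]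
  | insert a s ha ih =>
    simp only [Finset.sum_insert ha]
    exact (lipConst_add_le _ _ _).trans (by gcongr)

lemma lipConst_le_of_lipschitzOn {f : X → ℝ} {K : ℝ≥0} {x : X} {t : Set X} (ht : t ∈ 𝓝 x)
    (hf : LipschitzOnWith K f t) : lipConst f x ≤ K := by
  unfold lipConst
  refine limsup_le_of_le (by isBoundedDefault) ?_
  filter_upwards [nhdsWithin_le_nhds ht, self_mem_nhdsWithin] with y hy hne
  have hpos : 0 < dist y x := dist_pos.2 hne
  rw [← ENNReal.ofReal_coe_nnreal]
  refine ENNReal.ofReal_le_ofReal ?_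
  rw [div_le_iff₀ hpos, ← Real.dist_eq]
  exact hf.dist_le_mul y hy x (mem_of_mem_nhds ht)

lemma lipConst_le_of_lipschitzWith {f : X → ℝ} {K : ℝ≥0} (hf : LipschitzWith K f) (x : X) :
    lipConst f x ≤ K :=
  lipConst_le_of_lipschitzOn univ_mem hf.lipschitzOnWith

lemma lipConst_comp_le {f : X → ℝ} {φ : ℝ → ℝ} {K : ℝ≥0} (hφ : LipschitzWith K φ) (x : X) :
    lipConst (fun y => φ (f y)) x ≤ K * lipConst f x := by
  unfold lipConst
  rw [← ENNReal.limsup_const_mul_of_ne_top ENNReal.coe_ne_top]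
  refine limsup_le_limsup (Eventually.of_forall fun y => ?_)
  dsimp only
  rw [← ENNReal.ofReal_coe_nnreal, ← ENNReal.ofReal_mul K.coe_nonneg, ← mul_div_assoc]
  refine ENNReal.ofReal_le_ofReal (div_le_div_of_nonneg_right ?_ dist_nonneg)
  simpa [Real.dist_eq] using hφ.dist_le_mul (f y) (f x)

lemma lipConst_mul_le {φ f : X → ℝ} {x : X} (hφ : ContinuousAt φ x) (hf : lipConst f x ≠ ⊤) :
    lipConst (fun y => φ y * f y) x ≤
      ENNReal.ofReal |φ x| * lipConst f x + lipConst φ x * ENNReal.ofReal |f x| := by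
  rcases (𝓝[≠] x).eq_or_neBot with hbot | hne
  · simp [lipConst, hbot]
  have hlim : Tendsto (fun y => ENNReal.ofReal |φ y|) (𝓝[≠] x) (𝓝 (ENNReal.ofReal |φ x|)) :=
    (ENNReal.continuous_ofReal.tendsto _).comp
      ((continuous_abs.tendsto _).comp (hφ.tendsto.mono_left nhdsWithin_le_nhds))
  have h1 : limsup (fun y => ENNReal.ofReal |φ y| *
      ENNReal.ofReal (|f y - f x| / dist y x)) (𝓝[≠] x) ≤
      ENNReal.ofReal |φ x| * lipConst f x := by
    have := ENNReal.limsup_mul_le' (f := 𝓝[≠] x) (u := fun y => ENNReal.ofReal |φ y|)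
      (v := fun y => ENNReal.ofReal (|f y - f x| / dist y x)) (Or.inr hf)
      (Or.inl (by rw [hlim.limsup_eq]; exact ENNReal.ofReal_ne_top))
    rw [hlim.limsup_eq] at this
    exact this
  have h2 : limsup (fun y => ENNReal.ofReal |f x| *
      ENNReal.ofReal (|φ y - φ x| / dist y x)) (𝓝[≠] x) ≤
      lipConst φ x * ENNReal.ofReal |f x| := by
    rw [ENNReal.limsup_const_mul_of_ne_top ENNReal.ofReal_ne_top, mul_comm]
    rfl
  refine le_trans ?_ (add_le_add h1 h2)
  refine le_trans (limsup_le_limsup (Eventually.of_forall fun y => ?_))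
    (ennreal_limsup_add_le _ _ _)
  dsimp only
  rw [← ENNReal.ofReal_mul (abs_nonneg _), ← ENNReal.ofReal_mul (abs_nonneg _),
    ← ENNReal.ofReal_add (by positivity) (by positivity), ← mul_div_assoc, ← mul_div_assoc,
    ← add_div]
  refine ENNReal.ofReal_le_ofReal (div_le_div_of_nonneg_right ?_ dist_nonneg)
  rw [← abs_mul, ← abs_mul]
  refine le_trans (le_of_eq ?_) (abs_add_le _ _)
  ring_nf

lemma LocLipOn.exists_lipschitzOn {Ω : Set X} (hΩ : IsOpen Ω) {f : X → ℝ} (hf : LocLipOn Ω f)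
    {x : X} (hx : x ∈ Ω) : ∃ K : ℝ≥0, ∃ t ∈ 𝓝 x, LipschitzOnWith K f t := by
  obtain ⟨K, t, ht, h⟩ := hf x hx
  exact ⟨K, t, by rwa [hΩ.nhdsWithin_eq hx] at ht, h⟩

lemma LocLipOn.lipConst_ne_top {Ω : Set X} (hΩ : IsOpen Ω) {f : X → ℝ} (hf : LocLipOn Ω f)
    {x : X} (hx : x ∈ Ω) : lipConst f x ≠ ⊤ := by
  obtain ⟨K, t, ht, h⟩ := hf.exists_lipschitzOn hΩ hx
  exact ne_top_of_le_ne_top ENNReal.coe_ne_top (lipConst_le_of_lipschitzOn ht h)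

lemma LocLipOn.continuousOn {Ω : Set X} {f : X → ℝ} (hf : LocLipOn Ω f) :
    ContinuousOn f Ω := by
  intro x hx
  obtain ⟨K, t, ht, h⟩ := hf x hx
  have : ContinuousWithinAt f t x := h.continuousOn x (mem_of_mem_nhdsWithin hx ht)
  exact this.mono_of_mem_nhdsWithin ht

lemma LocLipOn.continuous {f : X → ℝ} (hf : LocLipOn univ f) : Continuous f :=
  continuousOn_univ.1 hf.continuousOn

lemma LocLipOn.congr {Ω : Set X} {f g : X → ℝ} (hf : LocLipOn Ω f) (h : EqOn g f Ω) :
    LocLipOn Ω g := fun x hx => by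
  obtain ⟨K, t, ht, hK⟩ := hf x hx
  refine ⟨K, t ∩ Ω, inter_mem ht self_mem_nhdsWithin, ?_⟩
  intro y hy z hz
  rw [h hy.2, h hz.2]
  exact hK hy.1 hz.1

lemma LocLipOn.comp_lipschitz {Ω : Set X} {f : X → ℝ} {φ : ℝ → ℝ} {C : ℝ≥0}
    (hf : LocLipOn Ω f) (hφ : LipschitzWith C φ) : LocLipOn Ω (fun x => φ (f x)) := fun x hx => by
  obtain ⟨K, t, ht, hK⟩ := hf x hx
  exact ⟨C * K, t, ht, hφ.comp_lipschitzOnWith hK⟩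

lemma LocLipOn.const_sub {Ω : Set X} {f : X → ℝ} (c : ℝ) (hf : LocLipOn Ω f) :
    LocLipOn Ω (fun x => c - f x) :=
  hf.comp_lipschitz (φ := fun s => c - s) (C := 1) (LipschitzWith.of_dist_le_mul fun a b => by
    rw [Real.dist_eq, Real.dist_eq, sub_sub_sub_cancel_left, abs_sub_comm]; simp)

lemma LipschitzWith.locLipOn {f : X → ℝ} {K : ℝ≥0} (hf : LipschitzWith K f) (Ω : Set X) :
    LocLipOn Ω f := fun _ _ => ⟨K, univ, univ_mem, hf.lipschitzOnWith⟩

lemma LocLipOn.add {Ω : Set X} {f g : X → ℝ} (hf : LocLipOn Ω f) (hg : LocLipOn Ω g) :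
    LocLipOn Ω (fun x => f x + g x) := fun x hx => by
  obtain ⟨K, t, ht, hK⟩ := hf x hx
  obtain ⟨K', t', ht', hK'⟩ := hg x hx
  exact ⟨K + K', t ∩ t', inter_mem ht ht',
    (hK.mono inter_subset_left).add (hK'.mono inter_subset_right)⟩

lemma LocLipOn.min {Ω : Set X} {f g : X → ℝ} (hf : LocLipOn Ω f) (hg : LocLipOn Ω g) :
    LocLipOn Ω (fun x => min (f x) (g x)) := fun x hx => by
  obtain ⟨K, t, ht, hK⟩ := hf x hx
  obtain ⟨K', t', ht', hK'⟩ := hg x hx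
  refine ⟨max K K', t ∩ t', inter_mem ht ht', LipschitzOnWith.of_dist_le_mul fun y hy z hz => ?_⟩
  rw [Real.dist_eq]
  refine (abs_min_sub_min_le_max _ _ _ _).trans (max_le ?_ ?_)
  · rw [← Real.dist_eq]
    refine (hK.dist_le_mul y hy.1 z hz.1).trans ?_
    gcongr
    exact le_max_left _ _
  · rw [← Real.dist_eq]
    refine (hK'.dist_le_mul y hy.2 z hz.2).trans ?_
    gcongr
    exact le_max_right _ _

lemma LocLipOn.mul {Ω : Set X} {f g : X → ℝ} (hf : LocLipOn Ω f) (hg : LocLipOn Ω g) :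
    LocLipOn Ω (fun x => f x * g x) := fun x hx => by
  obtain ⟨K, t, ht, hK⟩ := hf x hx
  obtain ⟨K', t', ht', hK'⟩ := hg x hx
  have cf : ∀ᶠ y in 𝓝[Ω] x, |f y| < |f x| + 1 :=
    (hf.continuousOn x hx).abs.eventually (gt_mem_nhds (lt_add_one _))
  have cg : ∀ᶠ y in 𝓝[Ω] x, |g y| < |g x| + 1 :=
    (hg.continuousOn x hx).abs.eventually (gt_mem_nhds (lt_add_one _))
  refine ⟨(|f x| + 1).toNNReal * K' + (|g x| + 1).toNNReal * K,
    (t ∩ t') ∩ ({y | |f y| < |f x| + 1} ∩ {y | |g y| < |g x| + 1}),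
    inter_mem (inter_mem ht ht') (inter_mem cf cg),
    LipschitzOnWith.of_dist_le_mul fun y hy z hz => ?_⟩
  have h1 := hK.dist_le_mul y hy.1.1 z hz.1.1
  have h2 := hK'.dist_le_mul y hy.1.2 z hz.1.2
  rw [Real.dist_eq] at h1 h2 ⊢
  push_cast
  rw [Real.coe_toNNReal _ (by positivity), Real.coe_toNNReal _ (by positivity)]
  have e : f y * g y - f z * g z = f y * (g y - g z) + g z * (f y - f z) := by ring
  rw [e]
  refine (abs_add_le _ _).trans ?_
  rw [abs_mul, abs_mul, add_mul, mul_assoc, mul_assoc]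
  have a1 : |f y| ≤ |f x| + 1 := le_of_lt hy.2.1
  have a2 : |g z| ≤ |g x| + 1 := le_of_lt hz.2.2
  gcongr

lemma LocLipOn.sum {ι : Type*} {Ω : Set X} (s : Finset ι) {f : ι → X → ℝ}
    (hf : ∀ i, LocLipOn Ω (f i)) : LocLipOn Ω (fun x => ∑ i ∈ s, f i x) := by
  classical
  induction s using Finset.induction_on with
  | empty => simpa using LipschitzWith.locLipOn (LipschitzWith.const (0 : ℝ)) Ω
  | insert a s ha ih =>
    simp only [Finset.sum_insert ha]
    exact (hf a).add ih

lemma locLipOn_of_eventuallyEq {Ω : Set X} {f : X → ℝ}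
    (h : ∀ x ∈ Ω, ∃ g : X → ℝ, LocLipOn univ g ∧ f =ᶠ[𝓝 x] g) : LocLipOn Ω f := fun x hx => by
  obtain ⟨g, hg, hfg⟩ := h x hx
  obtain ⟨K, t, ht, hK⟩ := hg.exists_lipschitzOn isOpen_univ (mem_univ x)
  refine ⟨K, t ∩ {y | f y = g y}, nhdsWithin_le_nhds (inter_mem ht hfg), ?_⟩
  intro y hy z hz
  rw [hy.2, hz.2]
  exact hK hy.1 hz.1

lemma measurable_indicator_lipConst [MeasurableSpace X] [OpensMeasurableSpace X] {Ω : Set X}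
    (hΩ : IsOpen Ω) {f : X → ℝ} (hf : ContinuousOn f Ω) :
    Measurable (Ω.indicator (lipConst f)) := by
  set S : ℕ → X → ℝ≥0∞ := fun k x => ⨆ y : {y : X // y ∈ Ω ∧ y ≠ x ∧ dist y x < 1 / ((k : ℝ) + 1)},
    ENNReal.ofReal (|f y - f x| / dist (y : X) x) with hS
  have hSm : ∀ k, Measurable (Ω.indicator (S k)) := by
    intro k
    refine measurable_of_Ioi fun c => ?_
    have : Ω.indicator (S k) ⁻¹' Ioi c = ⋃ y ∈ Ω, {x | x ∈ Ω ∧ y ≠ x ∧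
        dist y x < 1 / ((k : ℝ) + 1) ∧ c < ENNReal.ofReal (|f y - f x| / dist y x)} := by
      ext x
      simp only [mem_preimage, mem_Ioi, mem_iUnion, mem_ofPred_eq, exists_prop]
      by_cases hx : x ∈ Ω
      · rw [indicator_of_mem hx, hS]
        simp only [lt_iSup_iff, Subtype.exists, exists_prop]
        exact ⟨fun ⟨a, h, h'⟩ => ⟨a, h.1, hx, h.2.1, h.2.2, h'⟩,
          fun ⟨a, h, _, h1, h2, h3⟩ => ⟨a, ⟨h, h1, h2⟩, h3⟩⟩
      · simp [hx]
    rw [this]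
    refine IsOpen.measurableSet (isOpen_biUnion fun y hy => ?_)
    have hcont : ContinuousOn (fun x => ENNReal.ofReal (|f y - f x| / dist y x)) (Ω ∩ {y}ᶜ) := by
      refine ENNReal.continuous_ofReal.comp_continuousOn ?_
      refine ContinuousOn.div ((continuousOn_const.sub (hf.mono inter_subset_left)).abs)
        (by fun_prop) fun x hx => ?_
      exact (dist_pos.2 (Ne.symm hx.2)).ne'
    have ho := hcont.isOpen_inter_preimage (hΩ.inter isOpen_compl_singleton)
      (isOpen_Ioi (a := c))
    have ho2 : IsOpen {x | dist y x < 1 / ((k : ℝ) + 1)} :=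
      isOpen_lt (by fun_prop) continuous_const
    convert ho.inter ho2 using 1
    ext x
    simp only [mem_ofPred_eq, mem_inter_iff, mem_compl_iff, mem_singleton_iff, mem_preimage,
      mem_Ioi]
    constructor
    · rintro ⟨a, b, c, d⟩; exact ⟨⟨⟨a, Ne.symm b⟩, d⟩, c⟩
    · rintro ⟨⟨⟨a, b⟩, d⟩, c⟩; exact ⟨a, Ne.symm b, c, d⟩
  have : Ω.indicator (lipConst f) = fun x => ⨅ k, Ω.indicator (S k) x := by
    ext x
    by_cases hx : x ∈ Ω
    · simp only [indicator_of_mem hx]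
      refine le_antisymm (le_iInf fun k => ?_) ?_
      · unfold lipConst
        refine limsup_le_of_le (by isBoundedDefault) ?_
        filter_upwards [nhdsWithin_le_nhds (hΩ.mem_nhds hx), self_mem_nhdsWithin,
          nhdsWithin_le_nhds (ball_mem_nhds x (Nat.one_div_pos_of_nat (n := k) (α := ℝ)))]
          with y hy hne hd
        exact le_iSup (fun y : {y : X // y ∈ Ω ∧ y ≠ x ∧ dist y x < 1 / ((k : ℝ) + 1)} =>
          ENNReal.ofReal (|f y - f x| / dist (y : X) x)) ⟨y, hy, hne, hd⟩
      · unfold lipConst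
        refine le_limsup_of_le (by isBoundedDefault) fun b hb => ?_
        rw [eventually_nhdsWithin_iff, Metric.eventually_nhds_iff] at hb
        obtain ⟨ε, hε, hb⟩ := hb
        obtain ⟨k, hk⟩ := exists_nat_one_div_lt hε
        refine iInf_le_of_le k (iSup_le ?_)
        rintro ⟨y, hy, hne, hd⟩
        exact hb (hd.trans hk) hne
    · simp [indicator_of_notMem hx]
  rw [this]
  exact Measurable.iInf hSm

lemma measurable_lipConst [MeasurableSpace X] [OpensMeasurableSpace X] {f : X → ℝ}
    (hf : Continuous f) : Measurable (lipConst f) := by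
  simpa using measurable_indicator_lipConst isOpen_univ hf.continuousOn

end Slope

section Covers

variable {X : Type*} [MetricSpace X]

lemma iUnion_ball_two_pow_mul (x : X) {r : ℝ} (hr : 0 < r) :
    ⋃ k : ℕ, ball x (2 ^ k * r) = univ := by
  refine eq_univ_of_forall fun y => mem_iUnion.2 ?_
  obtain ⟨k, hk⟩ := pow_unbounded_of_one_lt (dist y x / r) one_lt_two
  exact ⟨k, by rw [mem_ball]; rwa [div_lt_iff₀ hr] at hk⟩

lemma exists_separated_cover [TopologicalSpace.SeparableSpace X] (S : Set X) {s : ℝ}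
    (hs : 0 < s) : ∃ J ⊆ S, J.Countable ∧ J.PairwiseDisjoint (fun y => closedBall y s) ∧
      S ⊆ ⋃ y ∈ J, ball y (6 * s) := by
  obtain ⟨J, hJS, hd, hc⟩ := Vitali.exists_disjoint_subfamily_covering_enlargement_closedBall
    S (fun y => y) (fun _ => s) s (fun _ _ => le_rfl) 5 (by norm_num)
  refine ⟨J, hJS, hd.countable_of_nonempty_interior fun y _ => ?_, hd, fun x hx => ?_⟩
  · exact ⟨y, mem_interior_iff_mem_nhds.2 (closedBall_mem_nhds y hs)⟩
  · obtain ⟨y, hy, hsub⟩ := hc x hx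
    refine mem_biUnion hy (closedBall_subset_ball ?_ (hsub (mem_closedBall_self hs.le)))
    linarith

end Covers

lemma lintegral_triangle {X : Type*} [MeasurableSpace X] {μ : Measure X} {f g h : X → ℝ}
    {K : Set X} (hf : Measurable f)
    (hg : Measurable g) :
    ∫⁻ x in K, ENNReal.ofReal |f x - h x| ∂μ ≤
      ∫⁻ x in K, ENNReal.ofReal |f x - g x| ∂μ + ∫⁻ x in K, ENNReal.ofReal |g x - h x| ∂μ := by
  rw [← lintegral_add_left (by fun_prop)]
  refine lintegral_mono fun x => ?_
  rw [← ENNReal.ofReal_add (abs_nonneg _) (abs_nonneg _)]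
  exact ENNReal.ofReal_le_ofReal (abs_sub_le _ _ _)

section DoublingSpaces

variable {X : Type*} [MetricSpace X] [MeasurableSpace X]

lemma Doubling.ball_pow_le {μ : Measure X} {C : ℝ≥0} (h : Doubling μ C) (x : X) {r : ℝ}
    (hr : 0 < r) (k : ℕ) : μ (ball x (2 ^ k * r)) ≤ (C : ℝ≥0∞) ^ k * μ (ball x r) := by
  induction k with
  | zero => simp
  | succ k ih =>
    calc μ (ball x (2 ^ (k + 1) * r)) = μ (ball x (2 * (2 ^ k * r))) := by ring_nf
      _ ≤ C * μ (ball x (2 ^ k * r)) := h.2 x _ (by positivity)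
      _ ≤ C * (C ^ k * μ (ball x r)) := by gcongr
      _ = _ := by ring

lemma Doubling.ball_pos {μ : Measure X} {C : ℝ≥0} (h : Doubling μ C) (hμ : μ ≠ 0) (x : X)
    {r : ℝ} (hr : 0 < r) : 0 < μ (ball x r) := by
  rw [pos_iff_ne_zero]
  intro h0
  refine hμ (Measure.measure_univ_eq_zero.1 ?_)
  rw [← iUnion_ball_two_pow_mul x hr, measure_iUnion_null_iff]
  intro k
  simpa [h0] using h.ball_pow_le x hr k

lemma Doubling.ball_lt_top {μ : Measure X} [IsLocallyFiniteMeasure μ] {C : ℝ≥0}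
    (h : Doubling μ C) (x : X) (r : ℝ) : μ (ball x r) < ⊤ := by
  obtain ⟨s, hs, hfin⟩ := μ.finiteAt_nhds x
  obtain ⟨ε, hε, hball⟩ := Metric.mem_nhds_iff.1 hs
  obtain ⟨k, hk⟩ := pow_unbounded_of_one_lt (r / ε) one_lt_two
  refine lt_of_le_of_lt (measure_mono (ball_subset_ball (ε₂ := 2 ^ k * ε) ?_)) ?_
  · rw [div_lt_iff₀ hε] at hk; exact hk.le
  · refine lt_of_le_of_lt (h.ball_pow_le x hε k) ?_
    exact ENNReal.mul_lt_top (by simp) (lt_of_le_of_lt (measure_mono hball) hfin)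

lemma Doubling.properSpace [CompleteSpace X] [TopologicalSpace.SeparableSpace X] [BorelSpace X]
    {μ : Measure X} [IsLocallyFiniteMeasure μ] {C : ℝ≥0} (h : Doubling μ C) (hμ : μ ≠ 0) :
    ProperSpace X := by
  refine ProperSpace.of_isCompact_closedBall_of_le 1 fun x R hR => ?_
  refine TotallyBounded.isCompact_of_isClosed (Metric.totallyBounded_iff.2 fun ε hε => ?_)
    isClosed_closedBall
  set s := min (ε / 6) 1 with hs
  have hs0 : 0 < s := by positivity
  obtain ⟨J, hJS, hJc, hd, hcov⟩ := exists_separated_cover (closedBall x R) hs0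
  refine ⟨J, ?_, hcov.trans (iUnion₂_mono fun y _ => ball_subset_ball ?_)⟩
  swap
  · have := min_le_left (ε / 6) 1
    linarith
  obtain ⟨k, hk⟩ := pow_unbounded_of_one_lt ((2 * R) / s) one_lt_two
  rw [div_lt_iff₀ hs0] at hk
  have hlow : ∀ y ∈ J, μ (ball x R) / (C : ℝ≥0∞) ^ k ≤ μ (closedBall y s) := by
    intro y hy
    refine ENNReal.div_le_of_le_mul' ?_
    calc μ (ball x R) ≤ μ (ball y (2 ^ k * s)) := by
          refine measure_mono (ball_subset_ball' ?_)
          have := mem_closedBall'.1 (hJS hy)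
          linarith
      _ ≤ C ^ k * μ (ball y s) := h.ball_pow_le y hs0 k
      _ ≤ C ^ k * μ (closedBall y s) := by gcongr; exact ball_subset_closedBall
  have hpos : 0 < μ (ball x R) / (C : ℝ≥0∞) ^ k :=
    ENNReal.div_pos (h.ball_pos hμ x (by linarith)).ne' (by simp)
  have hfin := Measure.finite_const_le_meas_of_disjoint_iUnion μ hpos
    (As := fun y : J => closedBall (y : X) s) (fun _ => measurableSet_closedBall)
    (fun a b hab => hd a.2 b.2 (fun e => hab (Subtype.ext e))) (ne_top_of_le_ne_top
      (h.ball_lt_top x (R + 2)).ne (measure_mono (iUnion_subset fun y => ?_)))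
  · have : Finite J := by
      refine Set.finite_univ_iff.1 (hfin.subset fun y _ => hlow y y.2)
    exact J.toFinite
  · refine closedBall_subset_ball' ?_
    have := mem_closedBall.1 (hJS y.2)
    have := min_le_right (ε / 6) 1
    linarith

end DoublingSpaces

section Exhaustion

variable {X : Type*} [MetricSpace X]

lemma exists_lipschitz_pos_iff_mem {Ω : Set X} (hΩ : IsOpen Ω) :
    ∃ D : X → ℝ, LipschitzWith 1 D ∧ (∀ x, 0 ≤ D x) ∧ ∀ x, 0 < D x ↔ x ∈ Ω := by
  rcases Ωᶜ.eq_empty_or_nonempty with h | h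
  · refine ⟨fun _ => 1, (LipschitzWith.const _).weaken zero_le_one, fun _ => zero_le_one,
      fun x => ?_⟩
    rw [compl_empty_iff] at h
    simp [h]
  · refine ⟨fun x => infDist x Ωᶜ, lipschitz_infDist_pt _, fun _ => infDist_nonneg, fun x => ?_⟩
    rw [← hΩ.isClosed_compl.notMem_iff_infDist_pos h, notMem_compl_iff]

/-- The piecewise linear function rising from `0` on `(-∞, 0]` to `1` on `[1, ∞)`. -/
noncomputable def clamp01 (s : ℝ) : ℝ := max 0 (min 1 s)

lemma clamp01_nonneg (s : ℝ) : 0 ≤ clamp01 s := le_max_left _ _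

lemma clamp01_le_one (s : ℝ) : clamp01 s ≤ 1 := max_le zero_le_one (min_le_left _ _)

lemma clamp01_of_nonpos {s : ℝ} (h : s ≤ 0) : clamp01 s = 0 :=
  max_eq_left ((min_le_right _ _).trans h)

lemma clamp01_of_one_le {s : ℝ} (h : 1 ≤ s) : clamp01 s = 1 := by
  simp [clamp01, h]

lemma clamp01_mono : Monotone clamp01 := fun a b h => by
  unfold clamp01; gcongr

lemma lipschitzWith_clamp01 : LipschitzWith 1 clamp01 :=
  (LipschitzWith.id.const_min 1).const_max 0

/-- Compactly supported Lipschitz cutoff functions increasing to the indicator of an open set. -/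
lemma exists_cutoffs [ProperSpace X] {Ω : Set X} (hΩ : IsOpen Ω) :
    ∃ η : ℕ → X → ℝ, (∀ k, ∃ L, LipschitzWith L (η k)) ∧ (∀ k x, 0 ≤ η k x) ∧
      (∀ k x, η k x ≤ 1) ∧ (∀ x, Monotone fun k => η k x) ∧
      (∀ k, ∃ K, IsCompact K ∧ K ⊆ Ω ∧ ∀ x ∉ K, η k x = 0) ∧
      ∀ x ∈ Ω, ∃ N, ∀ᶠ y in 𝓝 x, ∀ k ≥ N, η k y = 1 := by
  rcases isEmpty_or_nonempty X with hX | ⟨⟨x₀⟩⟩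
  · exact ⟨fun _ _ => 0, fun _ => ⟨0, LipschitzWith.const 0⟩, fun _ _ => le_rfl,
      fun _ _ => zero_le_one, fun _ => monotone_const,
      fun _ => ⟨∅, isCompact_empty, empty_subset _, fun _ _ => rfl⟩, fun x => isEmptyElim x⟩
  obtain ⟨D, hDL, hD0, hD⟩ := exists_lipschitz_pos_iff_mem hΩ
  refine ⟨fun k x => min (clamp01 (k * D x - 1)) (clamp01 (k - dist x x₀)), fun k => ?_,
    fun k x => le_min (clamp01_nonneg _) (clamp01_nonneg _),
    fun k x => (min_le_left _ _).trans (clamp01_le_one _), fun x k l hkl => ?_, fun k => ?_,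
    fun x hx => ?_⟩
  · have h1 : LipschitzWith (k : ℝ≥0) (fun x => k * D x - 1) :=
      LipschitzWith.of_dist_le_mul fun x y => by
        rw [dist_sub_right, Real.dist_eq, ← mul_sub, abs_mul, Nat.abs_cast, ← Real.dist_eq]
        have := hDL.dist_le_mul x y
        simp only [NNReal.coe_one, one_mul] at this
        push_cast
        gcongr
    have h2 : LipschitzWith 1 (fun x => (k : ℝ) - dist x x₀) :=
      LipschitzWith.of_dist_le_mul fun x y => by
        rw [Real.dist_eq, sub_sub_sub_cancel_left, abs_sub_comm, NNReal.coe_one, one_mul]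
        exact abs_dist_sub_le x y x₀
    exact ⟨_, (lipschitzWith_clamp01.comp h1).min (lipschitzWith_clamp01.comp h2)⟩
  · have hkl' : (k : ℝ) ≤ l := by exact_mod_cast hkl
    refine min_le_min (clamp01_mono ?_) (clamp01_mono ?_)
    · have := mul_le_mul_of_nonneg_right hkl' (hD0 x)
      linarith
    · linarith
  · refine ⟨{x | 1 ≤ k * D x} ∩ closedBall x₀ k, ?_, fun x hx => ?_, fun x hx => ?_⟩
    · exact (isCompact_closedBall x₀ (k : ℝ)).inter_left
        (isClosed_le continuous_const (continuous_const.mul hDL.continuous))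
    · refine (hD x).1 (lt_of_le_of_ne (hD0 x) fun h => ?_)
      have := hx.1
      simp only [mem_ofPred_eq, ← h, mul_zero] at this
      linarith
    · rw [mem_inter_iff, not_and_or, mem_ofPred_eq, mem_closedBall, not_le, not_le] at hx
      dsimp only
      rcases hx with h | h
      · rw [clamp01_of_nonpos (s := k * D x - 1) (by linarith)]
        exact min_eq_left (clamp01_nonneg _)
      · rw [clamp01_of_nonpos (s := (k : ℝ) - dist x x₀) (by linarith)]
        exact min_eq_right (clamp01_nonneg _)
  · have hDx := (hD x).2 hx
    obtain ⟨N, hN⟩ := exists_nat_ge (max (4 / D x) (dist x x₀ + 2))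
    refine ⟨N, ?_⟩
    have e1 : ∀ᶠ y in 𝓝 x, D x / 2 < D y :=
      hDL.continuous.continuousAt.eventually (lt_mem_nhds (by linarith))
    filter_upwards [e1, ball_mem_nhds x one_pos] with y hy1 hy2 k hk
    have hk' : (N : ℝ) ≤ k := by exact_mod_cast hk
    have a1 : 4 / D x ≤ k := (le_max_left _ _).trans (hN.trans hk')
    have a2 : dist x x₀ + 2 ≤ k := (le_max_right _ _).trans (hN.trans hk')
    rw [div_le_iff₀ hDx] at a1
    rw [mem_ball] at hy2
    rw [clamp01_of_one_le, clamp01_of_one_le, min_self]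
    · have := dist_triangle y x x₀
      linarith
    · have : (k : ℝ) * (D x / 2) ≤ k * D y := by gcongr
      linarith

lemma exists_exhaustion [ProperSpace X] {Ω : Set X} (hΩ : IsOpen Ω) :
    ∃ K : ℕ → Set X, (∀ n, IsCompact (K n)) ∧ (∀ n, K n ⊆ Ω) ∧
      ∀ K', IsCompact K' → K' ⊆ Ω → ∀ᶠ n in atTop, K' ⊆ K n := by
  obtain ⟨η, -, -, -, -, hK, h1⟩ := exists_cutoffs hΩ
  choose K hKc hKΩ hK0 using hK
  refine ⟨K, hKc, hKΩ, fun K' hK' hsub => ?_⟩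
  choose! N hN using h1
  obtain ⟨t, ht, hcov⟩ := hK'.elim_nhds_subcover (fun x => {y | ∀ k ≥ N x, η k y = 1})
    (fun x hx => hN x (hsub hx))
  filter_upwards [eventually_ge_atTop (t.sup N)] with n hn y hy
  obtain ⟨x, hx, hxy⟩ := mem_iUnion₂.1 (hcov hy)
  by_contra hcon
  have := hxy n ((Finset.le_sup hx).trans hn)
  rw [hK0 n y hcon] at this
  exact zero_ne_one this

end Exhaustion

section TotalVariation

variable {X : Type*} [MetricSpace X] [MeasurableSpace X]

lemma tv_le_tvOpen {μ : Measure X} {f : X → ℝ} {B Ω : Set X} (hΩ : IsOpen Ω) (hB : B ⊆ Ω) :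
    tv μ f B ≤ tvOpen μ f Ω :=
  iInf_le_of_le Ω (iInf_le_of_le hΩ (iInf_le_of_le hB le_rfl))

lemma tv_univ (μ : Measure X) (f : X → ℝ) : tv μ f univ = tvOpen μ f univ := by
  refine le_antisymm (tv_le_tvOpen isOpen_univ Subset.rfl) ?_
  refine le_iInf fun Ω => le_iInf fun _ => le_iInf fun hsub => ?_
  rw [univ_subset_iff.1 hsub]

lemma tvOpen_le_liminf {μ : Measure X} {f : X → ℝ} {Ω : Set X} {fn : ℕ → X → ℝ}
    (h1 : ∀ n, LocLipOn Ω (fn n)) (h2 : TendstoL1loc μ Ω fn f) :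
    tvOpen μ f Ω ≤ liminf (fun n => ∫⁻ x in Ω, lipConst (fn n) x ∂μ) atTop :=
  sInf_le ⟨fn, h1, h2, rfl⟩

lemma tvOpen_le_of_forall_le {μ : Measure X} {f : X → ℝ} {Ω : Set X} {fn : ℕ → X → ℝ} {c : ℝ≥0∞}
    (h1 : ∀ n, LocLipOn Ω (fn n)) (h2 : TendstoL1loc μ Ω fn f)
    (h3 : ∀ n, ∫⁻ x in Ω, lipConst (fn n) x ∂μ ≤ c) : tvOpen μ f Ω ≤ c :=
  (tvOpen_le_liminf h1 h2).trans
    ((liminf_le_liminf (Eventually.of_forall h3)).trans (by simp))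

lemma tendstoL1loc_of_exhaustion {μ : Measure X} {f : X → ℝ} {Ω : Set X} {fn : ℕ → X → ℝ}
    {K : ℕ → Set X} (hK : ∀ K', IsCompact K' → K' ⊆ Ω → ∀ᶠ n in atTop, K' ⊆ K n)
    {ε : ℕ → ℝ≥0∞} (hε : Tendsto ε atTop (𝓝 0))
    (h : ∀ n, ∫⁻ x in K n, ENNReal.ofReal |fn n x - f x| ∂μ ≤ ε n) : TendstoL1loc μ Ω fn f := by
  intro K' hK' hsub
  refine tendsto_of_tendsto_of_tendsto_of_le_of_le' tendsto_const_nhds hε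
    (Eventually.of_forall fun _ => zero_le) ?_
  filter_upwards [hK K' hK' hsub] with n hn
  exact (lintegral_mono_set hn).trans (h n)

lemma exists_approx_of_tvOpen_lt {μ : Measure X} {f : X → ℝ} {Ω : Set X} {a : ℝ≥0∞}
    (h : tvOpen μ f Ω < a) {K : Set X} (hK : IsCompact K) (hKΩ : K ⊆ Ω) {ε : ℝ≥0∞} (hε : 0 < ε) :
    ∃ g, LocLipOn Ω g ∧ ∫⁻ x in K, ENNReal.ofReal |g x - f x| ∂μ ≤ ε ∧
      ∫⁻ x in Ω, lipConst g x ∂μ < a := by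
  obtain ⟨b, ⟨fn, h1, h2, rfl⟩, hb⟩ := sInf_lt_iff.1 h
  obtain ⟨n, hn1, hn2⟩ := ((frequently_lt_of_liminf_lt (by isBoundedDefault) hb).and_eventually
    ((h2 K hK hKΩ).eventually (gt_mem_nhds hε))).exists
  exact ⟨fn n, h1 n, hn2.le, hn1⟩

/-- An almost optimal sequence, with quantitative convergence along an exhaustion. -/
lemma exists_approx_seq [ProperSpace X] {μ : Measure X} {f : X → ℝ} (h : tvOpen μ f univ ≠ ⊤) :
    ∃ fn : ℕ → X → ℝ, (∀ n, LocLipOn univ (fn n)) ∧ TendstoL1loc μ univ fn f ∧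
      ∀ n, ∫⁻ x, lipConst (fn n) x ∂μ ≤ tvOpen μ f univ + ((n : ℝ≥0∞) + 1)⁻¹ := by
  obtain ⟨K, hKc, hKu, hK⟩ := exists_exhaustion (X := X) isOpen_univ
  have hpos : ∀ n : ℕ, (0 : ℝ≥0∞) < ((n : ℝ≥0∞) + 1)⁻¹ := fun n => by
    rw [ENNReal.inv_pos]; finiteness
  have := fun n : ℕ => exists_approx_of_tvOpen_lt (μ := μ) (f := f)
    (ENNReal.lt_add_right h (hpos n).ne') (hKc n) (hKu n) (hpos n)
  choose fn h1 h2 h3 using this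
  refine ⟨fn, h1, tendstoL1loc_of_exhaustion hK ?_ h2, fun n => ?_⟩
  · have := ENNReal.tendsto_inv_nat_nhds_zero.comp (tendsto_add_atTop_nat 1)
    simpa [Function.comp_def] using this
  · simpa using (h3 n).le

/-- Lower semicontinuity of the total variation under `L¹_loc` convergence. -/
lemma tvOpen_univ_le_of_tendsto [ProperSpace X] [OpensMeasurableSpace X] {μ : Measure X}
    {f : X → ℝ} {un : ℕ → X → ℝ} (hu : ∀ n, Measurable (un n))
    (h : TendstoL1loc μ univ un f) {c : ℝ≥0∞} (hc : ∀ n, tvOpen μ (un n) univ ≤ c) :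
    tvOpen μ f univ ≤ c := by
  refine ENNReal.le_of_forall_pos_le_add fun ε hε hfin => ?_
  obtain ⟨K, hKc, hKu, hK⟩ := exists_exhaustion (X := X) isOpen_univ
  have hpos : ∀ n : ℕ, (0 : ℝ≥0∞) < ((n : ℝ≥0∞) + 1)⁻¹ := fun n => by
    rw [ENNReal.inv_pos]; finiteness
  have := fun n : ℕ => exists_approx_of_tvOpen_lt (μ := μ) (f := un n)
    (a := c + ε) (lt_of_le_of_lt (hc n) (ENNReal.lt_add_right hfin.ne (by simpa using hε.ne')))
    (hKc n) (hKu n) (hpos n)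
  choose fn h1 h2 h3 using this
  have hlim : TendstoL1loc μ univ (fun n x => fn n x - un n x) (fun _ => 0) := by
    refine tendstoL1loc_of_exhaustion hK (ε := fun n : ℕ => ((n : ℝ≥0∞) + 1)⁻¹) ?_
      (by simpa using h2)
    have := ENNReal.tendsto_inv_nat_nhds_zero.comp (tendsto_add_atTop_nat 1)
    simpa [Function.comp_def] using this
  refine tvOpen_le_of_forall_le h1 (fun K' hK' hu' => ?_) fun n => (h3 n).le
  have := (hlim K' hK' hu').add (h K' hK' hu')
  rw [add_zero] at this
  refine tendsto_of_tendsto_of_tendsto_of_le_of_le tendsto_const_nhds this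
    (fun _ => zero_le) fun n => ?_
  simpa using lintegral_triangle (h1 n).continuous.measurable (hu n)

lemma tvOpen_congr {μ : Measure X} {f g : X → ℝ} (h : f =ᵐ[μ] g) (Ω : Set X) :
    tvOpen μ f Ω = tvOpen μ g Ω := by
  have : ∀ fn, TendstoL1loc μ Ω fn f ↔ TendstoL1loc μ Ω fn g := by
    intro fn
    have : ∀ n K, ∫⁻ x in K, ENNReal.ofReal |fn n x - f x| ∂μ =
        ∫⁻ x in K, ENNReal.ofReal |fn n x - g x| ∂μ := fun n K =>
      lintegral_congr_ae (ae_restrict_of_ae (by filter_upwards [h] with x hx; rw [hx]))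
    simp only [TendstoL1loc, this]
  simp only [tvOpen, this]

lemma tv_congr {μ : Measure X} {f g : X → ℝ} (h : f =ᵐ[μ] g) (B : Set X) :
    tv μ f B = tv μ g B := by
  simp only [tv, tvOpen_congr h]

/-- If `Φ` is a 1-Lipschitz pointwise operation (for the `ℓ¹` norm) preserving local Lipschitz
functions, then the total variation of `Φ f g` is at most the sum of those of `f` and `g`. -/
lemma tvOpen_univ_le_add [ProperSpace X] [OpensMeasurableSpace X] {μ : Measure X}
    {f g : X → ℝ} (hf : Measurable f) (Φ : ℝ → ℝ → ℝ)
    (hΦ : ∀ a b c d, |Φ a b - Φ c d| ≤ |a - c| + |b - d|)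
    (hL : ∀ u v : X → ℝ, LocLipOn univ u → LocLipOn univ v → LocLipOn univ fun x => Φ (u x) (v x)) :
    tvOpen μ (fun x => Φ (f x) (g x)) univ ≤ tvOpen μ f univ + tvOpen μ g univ := by
  by_cases h1 : tvOpen μ f univ = ⊤
  · simp [h1]
  by_cases h2 : tvOpen μ g univ = ⊤
  · simp [h2]
  obtain ⟨fn, a1, a2, a3⟩ := exists_approx_seq h1
  obtain ⟨gn, b1, b2, b3⟩ := exists_approx_seq h2
  refine (tvOpen_le_liminf (fun n => hL _ _ (a1 n) (b1 n)) (fun K hK hu => ?_)).trans ?_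
  · have := (a2 K hK hu).add (b2 K hK hu)
    rw [add_zero] at this
    refine tendsto_of_tendsto_of_tendsto_of_le_of_le tendsto_const_nhds this
      (fun _ => zero_le) fun n => ?_
    have hm := (a1 n).continuous.measurable
    dsimp only
    rw [← lintegral_add_left (by fun_prop)]
    refine lintegral_mono fun x => ?_
    rw [← ENNReal.ofReal_add (abs_nonneg _) (abs_nonneg _)]
    exact ENNReal.ofReal_le_ofReal (hΦ _ _ _ _)
  · have hlim : Tendsto (fun n : ℕ => (tvOpen μ f univ + ((n : ℝ≥0∞) + 1)⁻¹) +
        (tvOpen μ g univ + ((n : ℝ≥0∞) + 1)⁻¹)) atTop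
        (𝓝 ((tvOpen μ f univ + 0) + (tvOpen μ g univ + 0))) := by
      have := ENNReal.tendsto_inv_nat_nhds_zero.comp (tendsto_add_atTop_nat 1)
      have h0 : Tendsto (fun n : ℕ => ((n : ℝ≥0∞) + 1)⁻¹) atTop (𝓝 0) := by
        simpa [Function.comp_def] using this
      exact (tendsto_const_nhds.add h0).add (tendsto_const_nhds.add h0)
    rw [add_zero, add_zero] at hlim
    rw [← hlim.liminf_eq]
    refine liminf_le_liminf (Eventually.of_forall fun n => ?_)
    rw [Measure.restrict_univ]
    refine le_trans ?_ (add_le_add (a3 n) (b3 n))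
    rw [← lintegral_add_left (measurable_lipConst (a1 n).continuous)]
    exact lintegral_mono fun x => lipConst_le_add_of_abs_le fun y => hΦ _ _ _ _

lemma tvOpen_const_sub_le {μ : Measure X} (c : ℝ) (f : X → ℝ) (Ω : Set X) :
    tvOpen μ (fun x => c - f x) Ω ≤ tvOpen μ f Ω := by
  refine le_sInf ?_
  rintro _ ⟨fn, h1, h2, rfl⟩
  refine (tvOpen_le_liminf (fun n => (h1 n).const_sub c) fun K hK hu => ?_).trans ?_
  · simpa [abs_sub_comm] using h2 K hK hu
  · simp [lipConst_const_sub]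

end TotalVariation

section VagueLimit

open scoped CompactlySupported

variable {X : Type*} [MetricSpace X] [ProperSpace X] [MeasurableSpace X] [BorelSpace X]

/-- Vague compactness: uniformly bounded measures converge vaguely along an ultrafilter. -/
lemma exists_vague_limit (m : ℕ → Measure X) {M : ℝ≥0} (hM : ∀ n, m n univ ≤ M) :
    ∃ ν : Measure X, ν univ ≤ M ∧ ∀ ψ : X → ℝ, Continuous ψ → (∀ x, 0 ≤ ψ x) →
      HasCompactSupport ψ → Tendsto (fun n => ∫⁻ x, ENNReal.ofReal (ψ x) ∂m n)
        (hyperfilter ℕ) (𝓝 (∫⁻ x, ENNReal.ofReal (ψ x) ∂ν)) := by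
  have hfin : ∀ n, IsFiniteMeasure (m n) := fun n => ⟨(hM n).trans_lt (by simp)⟩
  have hint : ∀ n (ψ : C_c(X, ℝ)), Integrable ψ (m n) := fun n ψ =>
    ψ.continuous.integrable_of_hasCompactSupport ψ.hasCompactSupport
  have hreal : ∀ n, (m n).real univ ≤ M := fun n => by
    simpa [Measure.real] using ENNReal.toReal_mono (by simp) (hM n)
  have hbd : ∀ (ψ : C_c(X, ℝ)) (c : ℝ), 0 ≤ c → (∀ x, |ψ x| ≤ c) → ∀ n,
      |∫ x, ψ x ∂m n| ≤ c * M := by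
    intro ψ c hc0 hc n
    calc |∫ x, ψ x ∂m n| ≤ c * (m n).real univ :=
          norm_integral_le_of_norm_le_const (f := ψ) (Eventually.of_forall hc)
      _ ≤ c * M := by gcongr; exact hreal n
  have hlim : ∀ ψ : C_c(X, ℝ), ∃ l, Tendsto (fun n => ∫ x, ψ x ∂m n) (hyperfilter ℕ) (𝓝 l) := by
    intro ψ
    obtain ⟨c, hc⟩ := ψ.continuous.bounded_above_of_compact_support ψ.hasCompactSupport
    obtain ⟨l, -, hl⟩ := (isCompact_Icc (a := -(|c| * M)) (b := |c| * M)).ultrafilter_le_nhds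
      ((hyperfilter ℕ).map fun n => ∫ x, ψ x ∂m n) (by
      rw [le_principal_iff, Ultrafilter.mem_coe, Ultrafilter.mem_map]
      exact Eventually.of_forall fun n => abs_le.1 (hbd ψ |c| (abs_nonneg c)
        (fun x => (hc x).trans (le_abs_self c)) n))
    exact ⟨l, hl⟩
  choose Λ hΛ using hlim
  let Λ' : C_c(X, ℝ) →ₚ[ℝ] ℝ := PositiveLinearMap.mk₀
    { toFun := Λ
      map_add' := fun f g => by
        refine tendsto_nhds_unique (hΛ (f + g)) (((hΛ f).add (hΛ g)).congr fun n => ?_)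
        exact (integral_add (hint n f) (hint n g)).symm
      map_smul' := fun c f => by
        refine tendsto_nhds_unique (hΛ (c • f)) (((hΛ f).const_mul c).congr fun n => ?_)
        exact (integral_const_mul c _).symm }
    fun f hf => ge_of_tendsto' (hΛ f) fun n => integral_nonneg hf
  refine ⟨RealRMK.rieszMeasure Λ', ?_, fun ψ hψ h0 hc => ?_⟩
  · rw [isOpen_univ.measure_eq_iSup_isCompact]
    refine iSup_le fun K => iSup_le fun _ => iSup_le fun hK => ?_
    obtain ⟨f, h1, -, hcs, hf⟩ := exists_continuous_one_zero_of_isCompact hK isClosed_empty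
      (disjoint_empty K)
    let f' : C_c(X, ℝ) := ⟨f, hcs⟩
    refine (RealRMK.rieszMeasure_le_of_eq_one Λ' (f := f') (fun x => (hf x).1) hK h1).trans ?_
    refine ENNReal.ofReal_le_of_le_toReal (le_of_tendsto' (hΛ f') fun n => ?_)
    have := hbd f' 1 zero_le_one (fun x =>
      abs_le.2 ⟨(show (-1 : ℝ) ≤ 0 by norm_num).trans (hf x).1, (hf x).2⟩) n
    simpa using (le_abs_self _).trans this
  · let f' : C_c(X, ℝ) := ⟨⟨ψ, hψ⟩, hc⟩
    have h1 : ∫ x, f' x ∂(RealRMK.rieszMeasure Λ') = Λ f' := RealRMK.integral_rieszMeasure Λ' f'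
    have h2 : Integrable ψ (RealRMK.rieszMeasure Λ') := hψ.integrable_of_hasCompactSupport hc
    rw [← ofReal_integral_eq_lintegral_ofReal h2 (Eventually.of_forall h0)]
    have h3 := (ENNReal.continuous_ofReal.tendsto _).comp (hΛ f')
    rw [← h1] at h3
    refine h3.congr fun n => ?_
    exact ofReal_integral_eq_lintegral_ofReal (hint n f') (Eventually.of_forall h0)

end VagueLimit

section Gluing

variable {X : Type*} [MetricSpace X]

/-- A locally finite Lipschitz partition of unity on an open set, subordinate to compact subsets. -/
lemma exists_lipschitz_partition [ProperSpace X] {Ω : Set X} (hΩ : IsOpen Ω) :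
    ∃ (φ : ℕ → X → ℝ) (K : ℕ → Set X) (L : ℕ → ℝ≥0), (∀ i, LipschitzWith (L i) (φ i)) ∧
      (∀ i x, 0 ≤ φ i x) ∧ (∀ i, IsCompact (K i)) ∧ (∀ i, K i ⊆ Ω) ∧ (∀ i, ∀ x ∉ K i, φ i x = 0) ∧
      (∀ n x, ∑ i ∈ Finset.range n, φ i x ≤ 1) ∧
      ∀ x ∈ Ω, ∃ N, ∀ᶠ y in 𝓝 x, ∑ i ∈ Finset.range N, φ i y = 1 ∧ ∀ i ≥ N, φ i y = 0 := by
  obtain ⟨η, hL, h0, h1, hmono, hK, hN⟩ := exists_cutoffs hΩ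
  choose L hL using hL
  choose K hKc hKΩ hK0 using hK
  let φ : ℕ → X → ℝ := fun i => Nat.casesOn i (η 0) (fun j x => η (j + 1) x - η j x)
  have hφ0 : ∀ i x, 0 ≤ φ i x := by
    rintro (_ | i) x
    · exact h0 0 x
    · exact sub_nonneg.2 (hmono x i.le_succ)
  have hφη : ∀ i x, φ i x ≤ η i x := by
    rintro (_ | i) x
    · exact le_rfl
    · exact sub_le_self _ (h0 i x)
  have hsum : ∀ n x, ∑ i ∈ Finset.range (n + 1), φ i x = η n x := by
    intro n x
    induction n with
    | zero => simp [φ]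
    | succ n ih => rw [Finset.sum_range_succ, ih]; simp [φ]
  refine ⟨φ, K, fun i => Nat.casesOn i (L 0) (fun j => L (j + 1) + L j), ?_, hφ0, hKc, hKΩ,
    fun i x hx => le_antisymm ((hφη i x).trans (hK0 i x hx).le) (hφ0 i x), ?_, fun x hx => ?_⟩
  · rintro (_ | i)
    · exact hL 0
    · exact (hL (i + 1)).sub (hL i)
  · rintro (_ | n) x
    · simp
    · rw [hsum]; exact h1 n x
  · obtain ⟨N, hN⟩ := hN x hx
    refine ⟨N + 1, ?_⟩
    filter_upwards [hN] with y hy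
    refine ⟨by rw [hsum, hy N le_rfl], ?_⟩
    rintro (_ | i) hi
    · omega
    · simp [φ, hy i (by omega), hy (i + 1) (by omega)]

variable [MeasurableSpace X]

/-- `ν` is the vague limit of the measures `ρ n • μ` along the filter `l`. -/
def VagueLim (μ : Measure X) (ρ : ℕ → X → ℝ≥0∞) (l : Filter ℕ) (ν : Measure X) : Prop :=
  ∀ ψ : X → ℝ, Continuous ψ → (∀ x, 0 ≤ ψ x) → HasCompactSupport ψ →
    Tendsto (fun n => ∫⁻ x, ρ n x * ENNReal.ofReal (ψ x) ∂μ) l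
      (𝓝 (∫⁻ x, ENNReal.ofReal (ψ x) ∂ν))

lemma exists_vagueLim [ProperSpace X] [BorelSpace X] {μ : Measure X} {ρ : ℕ → X → ℝ≥0∞}
    (hρ : ∀ n, Measurable (ρ n)) {M : ℝ≥0} (hM : ∀ n, ∫⁻ x, ρ n x ∂μ ≤ M) :
    ∃ ν : Measure X, ν univ ≤ M ∧ VagueLim μ ρ (hyperfilter ℕ) ν := by
  obtain ⟨ν, h1, h2⟩ := exists_vague_limit (fun n => μ.withDensity (ρ n)) (M := M)
    (by simpa using hM)
  refine ⟨ν, h1, fun ψ hψ h0 hc => (h2 ψ hψ h0 hc).congr fun n => ?_⟩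
  rw [lintegral_withDensity_eq_lintegral_mul _ (hρ n) hψ.measurable.ennreal_ofReal]
  rfl

lemma exists_locLipOn_of_vagueLim [ProperSpace X] [BorelSpace X] {μ ν : Measure X}
    {f : X → ℝ} (hf : Measurable f) {fn : ℕ → X → ℝ} (hfn : ∀ n, LocLipOn univ (fn n))
    (hlim : TendstoL1loc μ univ fn f) {ρ : ℕ → X → ℝ≥0∞} (hρ : ∀ n, Measurable (ρ n))
    (hlip : ∀ n x, lipConst (fn n) x ≤ ρ n x) {l : Filter ℕ} [l.NeBot] (hl : l ≤ atTop)
    (hν : VagueLim μ ρ l ν) (hfin : ν univ ≠ ⊤) {Ω : Set X} (hΩ : IsOpen Ω) {ε : ℝ≥0∞}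
    (hε : ε ≠ 0) : ∃ g, LocLipOn Ω g ∧ ∫⁻ x in Ω, ENNReal.ofReal |g x - f x| ∂μ ≤ ε ∧
      ∫⁻ x in Ω, lipConst g x ∂μ ≤ ν Ω + ε + ε := by
  obtain ⟨φ, K, L, hφL, hφ0, hK, hKΩ, hφK, hsum, hloc⟩ := exists_lipschitz_partition hΩ
  obtain ⟨ε', hε'0, hε'⟩ := ENNReal.exists_pos_sum_of_countable' hε ℕ
  have hφ1 : ∀ i x, φ i x ≤ 1 := fun i x =>
    (Finset.single_le_sum (f := fun i => φ i x) (fun j _ => hφ0 j x)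
      (Finset.self_mem_range_succ i)).trans (hsum (i + 1) x)
  have hφc : ∀ i, Continuous (φ i) := fun i => (hφL i).continuous
  have hchoice : ∀ i, ∃ n, ∫⁻ x, ρ n x * ENNReal.ofReal (φ i x) ∂μ ≤
      ∫⁻ x, ENNReal.ofReal (φ i x) ∂ν + ε' i ∧
      (L i + 1) * ∫⁻ x in K i, ENNReal.ofReal |fn n x - f x| ∂μ ≤ ε' i := by
    intro i
    have h1 := hν (φ i) (hφc i) (hφ0 i) (HasCompactSupport.intro (hK i) (hφK i))
    have hfin' : ∫⁻ x, ENNReal.ofReal (φ i x) ∂ν ≠ ⊤ := by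
      refine ne_top_of_le_ne_top hfin ?_
      calc ∫⁻ x, ENNReal.ofReal (φ i x) ∂ν ≤ ∫⁻ _, 1 ∂ν :=
            lintegral_mono fun x => by simpa using hφ1 i x
        _ = ν univ := by simp
    have h2 := ENNReal.Tendsto.const_mul (a := (L i + 1 : ℝ≥0∞))
      (hlim (K i) (hK i) (subset_univ _)) (Or.inr (by finiteness))
    rw [mul_zero] at h2
    obtain ⟨n, a, b⟩ := ((h1.eventually (gt_mem_nhds (ENNReal.lt_add_right hfin' (hε'0 i).ne'))).and
      (hl (h2.eventually (gt_mem_nhds (hε'0 i))))).exists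
    exact ⟨n, a.le, b.le⟩
  choose n hn1 hn2 using hchoice
  let g : X → ℝ := fun x => ∑' i, φ i x * fn (n i) x
  have hg : ∀ x N, (∀ i ≥ N, φ i x = 0) → g x = ∑ i ∈ Finset.range N, φ i x * fn (n i) x := by
    intro x N h
    refine tsum_eq_sum fun i hi => ?_
    rw [h i (by simpa using hi), zero_mul]
  have hdiff : ∀ i, Measurable fun x => ENNReal.ofReal |fn (n i) x - f x| := fun i => by
    have := (hfn (n i)).continuous.measurable
    fun_prop
  have hKm : ∀ i, MeasurableSet (K i) := fun i => (hK i).measurableSet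
  refine ⟨g, locLipOn_of_eventuallyEq fun x hx => ?_, ?_, ?_⟩
  · obtain ⟨N, hN⟩ := hloc x hx
    refine ⟨fun y => ∑ i ∈ Finset.range N, φ i y * fn (n i) y, LocLipOn.sum _ fun i =>
      (LipschitzWith.locLipOn (hφL i) _).mul (hfn _), ?_⟩
    filter_upwards [hN] with y hy using hg y N hy.2
  · calc ∫⁻ x in Ω, ENNReal.ofReal |g x - f x| ∂μ
        ≤ ∫⁻ x in Ω, ∑' i, (K i).indicator (fun x => ENNReal.ofReal |fn (n i) x - f x|) x ∂μ := by
          refine setLIntegral_mono' hΩ.measurableSet fun x hx => ?_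
          obtain ⟨N, hN⟩ := hloc x hx
          obtain ⟨h1, h2⟩ := hN.self_of_nhds
          rw [hg x N h2]
          refine le_trans ?_ (ENNReal.sum_le_tsum (Finset.range N))
          have : ∑ i ∈ Finset.range N, φ i x * fn (n i) x - f x =
              ∑ i ∈ Finset.range N, φ i x * (fn (n i) x - f x) := by
            simp only [mul_sub, Finset.sum_sub_distrib, ← Finset.sum_mul, h1, one_mul]
          rw [this]
          refine (ENNReal.ofReal_le_ofReal (Finset.abs_sum_le_sum_abs _ _)).trans ?_
          rw [ENNReal.ofReal_sum_of_nonneg fun _ _ => abs_nonneg _]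
          refine Finset.sum_le_sum fun i _ => ?_
          by_cases hxK : x ∈ K i
          · rw [indicator_of_mem hxK, abs_mul, abs_of_nonneg (hφ0 i x)]
            exact ENNReal.ofReal_le_ofReal (mul_le_of_le_one_left (abs_nonneg _) (hφ1 i x))
          · simp [hφK i x hxK]
      _ ≤ ∫⁻ x, ∑' i, (K i).indicator (fun x => ENNReal.ofReal |fn (n i) x - f x|) x ∂μ :=
          setLIntegral_le_lintegral _ _
      _ = ∑' i, ∫⁻ x in K i, ENNReal.ofReal |fn (n i) x - f x| ∂μ := by
          rw [lintegral_tsum fun i => ((hdiff i).indicator (hKm i)).aemeasurable]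
          simp only [lintegral_indicator (hKm _)]
      _ ≤ ∑' i, ε' i := by
          refine ENNReal.tsum_le_tsum fun i => le_trans ?_ (hn2 i)
          exact le_mul_of_one_le_left zero_le le_add_self
      _ ≤ ε := hε'.le
  · calc ∫⁻ x in Ω, lipConst g x ∂μ
        ≤ ∫⁻ x in Ω, ∑' i, (ρ (n i) x * ENNReal.ofReal (φ i x) +
            L i * (K i).indicator (fun x => ENNReal.ofReal |fn (n i) x - f x|) x) ∂μ := by
          refine setLIntegral_mono' hΩ.measurableSet fun x hx => ?_
          obtain ⟨N, hN⟩ := hloc x hx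
          have heq : g =ᶠ[𝓝 x] fun y =>
              ∑ i ∈ Finset.range N, φ i y * (fn (n i) y - f x) - (- f x) := by
            filter_upwards [hN] with y hy
            simp only [hg y N hy.2, mul_sub, Finset.sum_sub_distrib, ← Finset.sum_mul, hy.1,
              one_mul, sub_neg_eq_add, sub_add_cancel]
          rw [lipConst_congr heq, lipConst_sub_const]
          refine (lipConst_sum_le _ _ _).trans (le_trans ?_ (ENNReal.sum_le_tsum (Finset.range N)))
          refine Finset.sum_le_sum fun i _ => ?_
          refine (lipConst_mul_le (hφc i).continuousAt ?_).trans ?_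
          · rw [lipConst_sub_const]
            exact (hfn (n i)).lipConst_ne_top isOpen_univ (mem_univ x)
          · rw [lipConst_sub_const, abs_of_nonneg (hφ0 i x), mul_comm]
            refine add_le_add (mul_le_mul_left (hlip _ _) _) ?_
            by_cases hxK : x ∈ K i
            · rw [indicator_of_mem hxK]
              gcongr
              exact lipConst_le_of_lipschitzWith (hφL i) x
            · rw [lipConst_eq_zero_of_eventuallyEq_const (c := 0), zero_mul]
              · exact zero_le
              · filter_upwards [(hK i).isClosed.isOpen_compl.mem_nhds hxK] with y hy
                using hφK i y hy
      _ ≤ ∫⁻ x, ∑' i, (ρ (n i) x * ENNReal.ofReal (φ i x) +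
            L i * (K i).indicator (fun x => ENNReal.ofReal |fn (n i) x - f x|) x) ∂μ :=
          setLIntegral_le_lintegral _ _
      _ = ∑' i, (∫⁻ x, ρ (n i) x * ENNReal.ofReal (φ i x) ∂μ +
            L i * ∫⁻ x in K i, ENNReal.ofReal |fn (n i) x - f x| ∂μ) := by
          have m1 : ∀ i, Measurable fun x => ρ (n i) x * ENNReal.ofReal (φ i x) := fun i =>
            (hρ _).mul (hφc i).measurable.ennreal_ofReal
          have m2 := fun i => (hdiff i).indicator (hKm i)
          refine (lintegral_tsum fun i =>
            ((m1 i).add ((m2 i).const_mul (L i : ℝ≥0∞))).aemeasurable).trans ?_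
          refine tsum_congr fun i => ?_
          simp only [Pi.add_apply]
          rw [lintegral_add_left (m1 i), lintegral_const_mul _ (m2 i), lintegral_indicator (hKm i)]
      _ ≤ ∑' i, (∫⁻ x, ENNReal.ofReal (φ i x) ∂ν + ε' i + ε' i) := by
          refine ENNReal.tsum_le_tsum fun i => add_le_add (hn1 i) (le_trans ?_ (hn2 i))
          gcongr
          exact le_self_add
      _ = ∫⁻ x, ∑' i, ENNReal.ofReal (φ i x) ∂ν + ∑' i, ε' i + ∑' i, ε' i := by
          rw [ENNReal.tsum_add, ENNReal.tsum_add,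
            lintegral_tsum fun i => (hφc i).measurable.ennreal_ofReal.aemeasurable]
      _ ≤ ν Ω + ε + ε := by
          refine add_le_add_three ?_ hε'.le hε'.le
          rw [← lintegral_indicator_one hΩ.measurableSet]
          refine lintegral_mono fun x => ENNReal.tsum_le_of_sum_range_le fun N => ?_
          by_cases hx : x ∈ Ω
          · rw [indicator_of_mem hx, ← ENNReal.ofReal_sum_of_nonneg fun i _ => hφ0 i x]
            simpa using hsum N x
          · have : ∀ i, φ i x = 0 := fun i => hφK i x fun h => hx (hKΩ i h)
            simp [this]

/-- The total variation of the limit is dominated by the vague limit of the slopes. -/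
lemma tvOpen_le_of_vagueLim [ProperSpace X] [BorelSpace X] {μ ν : Measure X}
    {f : X → ℝ} (hf : Measurable f) {fn : ℕ → X → ℝ} (hfn : ∀ n, LocLipOn univ (fn n))
    (hlim : TendstoL1loc μ univ fn f) {ρ : ℕ → X → ℝ≥0∞} (hρ : ∀ n, Measurable (ρ n))
    (hlip : ∀ n x, lipConst (fn n) x ≤ ρ n x) {l : Filter ℕ} [l.NeBot] (hl : l ≤ atTop)
    (hν : VagueLim μ ρ l ν) (hfin : ν univ ≠ ⊤) {Ω : Set X} (hΩ : IsOpen Ω) :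
    tvOpen μ f Ω ≤ ν Ω := by
  have hpos : ∀ n : ℕ, ((n : ℝ≥0∞) + 1)⁻¹ ≠ 0 := fun n => by
    rw [Ne, ENNReal.inv_eq_zero]; finiteness
  have := fun n : ℕ => exists_locLipOn_of_vagueLim hf hfn hlim hρ hlip hl hν hfin hΩ (hpos n)
  choose g hg1 hg2 hg3 using this
  have h0 : Tendsto (fun n : ℕ => ((n : ℝ≥0∞) + 1)⁻¹) atTop (𝓝 0) := by
    simpa [Function.comp_def] using
      ENNReal.tendsto_inv_nat_nhds_zero.comp (tendsto_add_atTop_nat 1)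
  refine (tvOpen_le_liminf hg1 fun K _ hKΩ => ?_).trans ?_
  · exact tendsto_of_tendsto_of_tendsto_of_le_of_le tendsto_const_nhds h0 (fun _ => zero_le)
      fun n => (lintegral_mono_set hKΩ).trans (hg2 n)
  · have h1 := (tendsto_const_nhds (x := ν Ω)).add h0 |>.add h0
    rw [add_zero, add_zero] at h1
    rw [← h1.liminf_eq]
    exact liminf_le_liminf (Eventually.of_forall hg3)

end Gluing

section DensityPoints

variable {X : Type*} [MetricSpace X] [MeasurableSpace X] [BorelSpace X]

/-- Bounded overlap of enlarged balls in a doubling space. -/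
lemma Doubling.tsum_measure_closedBall_le {μ : Measure X} [IsLocallyFiniteMeasure μ] {C : ℝ≥0}
    (h : Doubling μ C) (hμ : μ ≠ 0) {J : Set X} (hJ : J.Countable) {s c : ℝ} (hs : 0 < s)
    (hc : 0 ≤ c) (hd : J.PairwiseDisjoint fun y => closedBall y s) {k : ℕ}
    (hk : 2 * c + 1 ≤ 2 ^ k) (ν : Measure X) :
    ∑' y : J, ν (closedBall (y : X) (c * s)) ≤ (C : ℝ≥0∞) ^ k * ν univ := by
  have : Countable J := hJ.to_subtype
  have hpt : ∀ x : X, ∑' y : J, (closedBall (y : X) (c * s)).indicator (1 : X → ℝ≥0∞) x ≤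
      (C : ℝ≥0∞) ^ k := by
    intro x
    set m := μ (ball x ((c + 1) * s)) with hm
    have hm0 : m ≠ 0 := (h.ball_pos hμ x (by positivity)).ne'
    have hmt : m ≠ ⊤ := (h.ball_lt_top x _).ne
    classical
    let A : J → Set X := fun y => if x ∈ closedBall (y : X) (c * s) then ball (y : X) s else ∅
    have hA : ∀ y, A y ⊆ closedBall (y : X) s := fun y => by
      simp only [A]; split_ifs
      · exact ball_subset_closedBall
      · exact empty_subset _
    have hAm : ∀ y, MeasurableSet (A y) := fun y => by
      simp only [A]; split_ifs
      · exact measurableSet_ball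
      · exact MeasurableSet.empty
    have hAd : Pairwise (Function.onFun Disjoint A) := fun a b hab =>
      (hd a.2 b.2 fun e => hab (Subtype.ext e)).mono (hA a) (hA b)
    have key : (∑' y : J, (closedBall (y : X) (c * s)).indicator (1 : X → ℝ≥0∞) x) * m ≤
        (C : ℝ≥0∞) ^ k * m := by
      calc (∑' y : J, (closedBall (y : X) (c * s)).indicator (1 : X → ℝ≥0∞) x) * m
          = ∑' y : J, (closedBall (y : X) (c * s)).indicator (1 : X → ℝ≥0∞) x * m :=
            ENNReal.tsum_mul_right.symm
        _ ≤ ∑' y : J, (C : ℝ≥0∞) ^ k * μ (A y) := by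
            refine ENNReal.tsum_le_tsum fun y => ?_
            by_cases hx : x ∈ closedBall (y : X) (c * s)
            · simp only [indicator_of_mem hx, Pi.one_apply, one_mul, A, if_pos hx]
              refine le_trans (measure_mono (ball_subset_ball' ?_)) (h.ball_pow_le (y : X) hs k)
              have := mem_closedBall.1 hx
              nlinarith
            · simp [hx]
        _ = (C : ℝ≥0∞) ^ k * μ (⋃ y, A y) := by
            rw [ENNReal.tsum_mul_left, measure_iUnion hAd hAm]
        _ ≤ (C : ℝ≥0∞) ^ k * m := by
            refine mul_le_mul_right (measure_mono (iUnion_subset fun y => ?_)) _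
            simp only [A]; split_ifs with hx
            · refine ball_subset_ball' ?_
              have := mem_closedBall'.1 hx
              linarith
            · exact empty_subset _
    exact (ENNReal.mul_le_mul_iff_left hm0 hmt).1 key
  calc ∑' y : J, ν (closedBall (y : X) (c * s))
      = ∫⁻ x, ∑' y : J, (closedBall (y : X) (c * s)).indicator (1 : X → ℝ≥0∞) x ∂ν := by
        rw [lintegral_tsum fun y =>
          (measurable_one.indicator measurableSet_closedBall).aemeasurable]
        simp only [lintegral_indicator_one measurableSet_closedBall]
    _ ≤ ∫⁻ _, (C : ℝ≥0∞) ^ k ∂ν := lintegral_mono hpt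
    _ = (C : ℝ≥0∞) ^ k * ν univ := by simp

variable [ProperSpace X]

/-- The relative isoperimetric inequality in the limit. -/
lemma measure_diff_le_of_vagueLim {μ ν : Measure X} {CP lam : ℝ} (hlam : 1 ≤ lam)
    (hP : WeakPoincare μ CP lam) {E : Set X} (hE : MeasurableSet E) {en : ℕ → X → ℝ}
    (hen : ∀ n, LocLipOn univ (en n))
    (hlim : TendstoL1loc μ univ en (E.indicator fun _ => (1 : ℝ))) {ρ : ℕ → X → ℝ≥0∞}
    (hlip : ∀ n x, lipConst (en n) x ≤ ρ n x) {l : Filter ℕ} [l.NeBot] (hl : l ≤ atTop)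
    (hν : VagueLim μ ρ l ν) {y : X} {t : ℝ} (ht : 0 < t)
    (hhalf : μ (ball y t \ E) ≤ μ (ball y t ∩ E)) :
    μ (ball y t \ E) ≤ ENNReal.ofReal (CP * t) * ν (closedBall y (2 * (lam * t))) := by
  have hlt : 0 < lam * t := by positivity
  let ψ : X → ℝ := fun x => clamp01 (2 - dist x y / (lam * t))
  have hψc : Continuous ψ := lipschitzWith_clamp01.continuous.comp (by fun_prop)
  have hψ0 : ∀ x ∉ closedBall y (2 * (lam * t)), ψ x = 0 := fun x hx => by
    refine clamp01_of_nonpos ?_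
    rw [mem_closedBall, not_le] at hx
    rw [sub_nonpos, le_div_iff₀ hlt]
    exact hx.le
  have hψ1 : ∀ x ∈ ball y (lam * t), ψ x = 1 := fun x hx => by
    refine clamp01_of_one_le ?_
    have : dist x y / (lam * t) ≤ 1 := (div_le_one hlt).2 (mem_ball.1 hx).le
    linarith
  have h1 := hν ψ hψc (fun _ => clamp01_nonneg _)
    (HasCompactSupport.intro (isCompact_closedBall y _) hψ0)
  have h2 := (hlim _ (isCompact_closedBall y t) (subset_univ _)).mono_left hl
  have h3 := h2.add (ENNReal.Tendsto.const_mul (a := ENNReal.ofReal (CP * t)) h1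
    (Or.inr ENNReal.ofReal_ne_top))
  rw [zero_add] at h3
  refine le_trans (ge_of_tendsto' h3 fun n => ?_) ?_
  · set a := ballAvg μ (en n) y t
    have hm := (hen n).continuous.measurable
    have hi : Measurable (E.indicator fun _ => (1 : ℝ)) := measurable_const.indicator hE
    calc μ (ball y t \ E)
        ≤ ∫⁻ x in ball y t, ENNReal.ofReal |E.indicator (fun _ => (1 : ℝ)) x - a| ∂μ := by
          rw [← lintegral_inter_add_sdiff _ _ hE]
          have e1 : ∫⁻ x in ball y t ∩ E, ENNReal.ofReal |E.indicator (fun _ => (1 : ℝ)) x - a| ∂μ =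
              ENNReal.ofReal |1 - a| * μ (ball y t ∩ E) := by
            rw [← setLIntegral_const]
            refine setLIntegral_congr_fun (measurableSet_ball.inter hE) fun x hx => ?_
            simp [hx.2]
          have e2 : ∫⁻ x in ball y t \ E, ENNReal.ofReal |E.indicator (fun _ => (1 : ℝ)) x - a| ∂μ =
              ENNReal.ofReal |a| * μ (ball y t \ E) := by
            rw [← setLIntegral_const]
            refine setLIntegral_congr_fun (measurableSet_ball.diff hE) fun x hx => ?_
            simp [hx.2]
          rw [e1, e2]
          calc μ (ball y t \ E)
              ≤ (ENNReal.ofReal |1 - a| + ENNReal.ofReal |a|) * μ (ball y t \ E) := by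
                refine le_mul_of_one_le_left zero_le ?_
                rw [← ENNReal.ofReal_add (abs_nonneg _) (abs_nonneg _), ENNReal.one_le_ofReal]
                have := abs_add_le (1 - a) a
                simpa using this
            _ ≤ _ := by rw [add_mul]; gcongr
      _ ≤ ∫⁻ x in ball y t, ENNReal.ofReal |E.indicator (fun _ => (1 : ℝ)) x - en n x| ∂μ +
          ∫⁻ x in ball y t, ENNReal.ofReal |en n x - a| ∂μ := lintegral_triangle hi hm
      _ ≤ _ := by
          refine add_le_add ?_ ((hP (en n) (hen n) y t ht).trans ?_)
          · simp only [abs_sub_comm]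
            exact lintegral_mono_set ball_subset_closedBall
          · refine mul_le_mul_right ?_ _
            rw [← lintegral_indicator measurableSet_ball]
            refine lintegral_mono fun x => ?_
            by_cases hx : x ∈ ball y (lam * t)
            · simpa [hx, hψ1 x hx] using hlip n x
            · simp [hx]
  · gcongr
    rw [← lintegral_indicator_one measurableSet_closedBall]
    refine lintegral_mono fun x => ?_
    by_cases hx : x ∈ closedBall y (2 * (lam * t))
    · simpa [indicator_of_mem hx] using clamp01_le_one _
    · simp [hψ0 x hx]

/-- Near a set of points where `E` has density close to one uniformly at small scales, the
complement of `E` occupies little space. -/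
lemma measure_neighborhood_diff_le {μ ν : Measure X} [IsLocallyFiniteMeasure μ] {C : ℝ≥0}
    (hD : Doubling μ C) (hμ : μ ≠ 0)
    {CP lam : ℝ} (hlam : 1 ≤ lam) (hP : WeakPoincare μ CP lam) {E : Set X}
    (hE : MeasurableSet E) {en : ℕ → X → ℝ} (hen : ∀ n, LocLipOn univ (en n))
    (hlim : TendstoL1loc μ univ en (E.indicator fun _ => (1 : ℝ))) {ρ : ℕ → X → ℝ≥0∞}
    (hlip : ∀ n x, lipConst (en n) x ≤ ρ n x) {l : Filter ℕ} [l.NeBot] (hl : l ≤ atTop)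
    (hν : VagueLim μ ρ l ν) {k' : ℕ} (hk' : 24 * lam + 1 ≤ 2 ^ k') {δ : ℝ} (hδ : 0 < δ)
    (hδ1 : δ ≤ 1) {k : ℕ} (hk : 10 ≤ 2 ^ k * (6 * δ)) {η : ℝ≥0∞} (hη : η * (C : ℝ≥0∞) ^ k ≤ 2⁻¹)
    {S : Set X} (hS : S.Nonempty) {R : ℝ}
    (hdens : ∀ x ∈ S, ∀ t, 0 < t → t < R → μ (ball x t \ E) ≤ η * μ (ball x t)) {r : ℝ} (hr : 0 < r)
    (hrR : 8 * r < R) :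
    μ ({x | infDist x S ≤ r} \ E) ≤
      ENNReal.ofReal r * (ENNReal.ofReal (6 * CP * δ) * ((C : ℝ≥0∞) ^ k' * ν univ)) := by
  have hs : 0 < δ * r := by positivity
  obtain ⟨J, hJS, hJc, hJd, hcov⟩ := exists_separated_cover {x | infDist x S ≤ r} hs
  have : Countable J := hJc.to_subtype
  have hball : ∀ y ∈ J, μ (ball y (6 * (δ * r)) \ E) ≤
      ENNReal.ofReal (CP * (6 * (δ * r))) * ν (closedBall y ((12 * lam) * (δ * r))) := by
    intro y hy
    have h6 : 0 < 6 * (δ * r) := by positivity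
    have := measure_diff_le_of_vagueLim hlam hP hE hen hlim hlip hl hν (y := y) h6 ?_
    · convert this using 4; ring
    have hfin := hD.ball_lt_top y (6 * (δ * r))
    have hyS : infDist y S < 2 * r := lt_of_le_of_lt (hJS hy) (by linarith)
    obtain ⟨x, hxS, hxy⟩ := (infDist_lt_iff hS).1 hyS
    have hδr : δ * r ≤ r := mul_le_of_le_one_left hr.le hδ1
    have hhalf : μ (ball y (6 * (δ * r)) \ E) ≤ 2⁻¹ * μ (ball y (6 * (δ * r))) := by
      calc μ (ball y (6 * (δ * r)) \ E) ≤ μ (ball x (8 * r) \ E) := by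
            refine measure_mono (sdiff_le_sdiff_right (ball_subset_ball' ?_))
            linarith
        _ ≤ η * μ (ball x (8 * r)) := hdens x hxS _ (by positivity) hrR
        _ ≤ η * μ (ball y (2 ^ k * (6 * (δ * r)))) := by
            gcongr
            refine ball_subset_ball' ?_
            rw [dist_comm]
            nlinarith
        _ ≤ η * ((C : ℝ≥0∞) ^ k * μ (ball y (6 * (δ * r)))) := by
            gcongr; exact hD.ball_pow_le y h6 k
        _ ≤ _ := by rw [← mul_assoc]; gcongr
    have hsplit := measure_inter_add_sdiff (μ := μ) (ball y (6 * (δ * r))) hE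
    have hfin' : μ (ball y (6 * (δ * r)) \ E) ≠ ⊤ := ne_top_of_le_ne_top hfin.ne
      (measure_mono sdiff_subset)
    refine (ENNReal.add_le_add_iff_right hfin').1 ?_
    rw [hsplit, ← two_mul]
    calc 2 * μ (ball y (6 * (δ * r)) \ E) ≤ 2 * (2⁻¹ * μ (ball y (6 * (δ * r)))) := by gcongr
      _ = _ := by rw [← mul_assoc, ENNReal.mul_inv_cancel (by simp) (by simp), one_mul]
  calc μ ({x | infDist x S ≤ r} \ E) ≤ μ (⋃ y : J, ball (y : X) (6 * (δ * r)) \ E) := by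
        refine measure_mono fun x hx => ?_
        obtain ⟨y, hy, hxy⟩ := mem_iUnion₂.1 (hcov hx.1)
        exact mem_iUnion.2 ⟨⟨y, hy⟩, hxy, hx.2⟩
    _ ≤ ∑' y : J, μ (ball (y : X) (6 * (δ * r)) \ E) := measure_iUnion_le _
    _ ≤ ∑' y : J, ENNReal.ofReal (CP * (6 * (δ * r))) *
          ν (closedBall (y : X) ((12 * lam) * (δ * r))) :=
        ENNReal.tsum_le_tsum fun y => hball y y.2
    _ = ENNReal.ofReal (CP * (6 * (δ * r))) *
          ∑' y : J, ν (closedBall (y : X) ((12 * lam) * (δ * r))) := ENNReal.tsum_mul_left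
    _ ≤ ENNReal.ofReal (CP * (6 * (δ * r))) * ((C : ℝ≥0∞) ^ k' * ν univ) := by
        gcongr
        exact hD.tsum_measure_closedBall_le hμ hJc hs (by positivity) hJd (by linarith) ν
    _ = _ := by
        rw [← mul_assoc (ENNReal.ofReal r), ← ENNReal.ofReal_mul hr.le]
        congr 2; ring

end DensityPoints

section DensityPoints

variable {X : Type*} [MetricSpace X] [MeasurableSpace X] [BorelSpace X] [ProperSpace X]

/-- The cutoff function equal to one on `S` and vanishing at distance `r` from `S`. -/
noncomputable def cutoffNear (S : Set X) (r : ℝ) (x : X) : ℝ := clamp01 (1 - infDist x S / r)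

/-- Filling in the complement of `E` near `S` saves the limit mass of `S`. -/
lemma tvOpen_add_measure_le {μ ν : Measure X} {E : Set X}
    (hE : MeasurableSet E) {en : ℕ → X → ℝ} (hen : ∀ n, LocLipOn univ (en n))
    (hlim : TendstoL1loc μ univ en (E.indicator fun _ => (1 : ℝ))) {ρ : ℕ → X → ℝ≥0∞}
    (hρ : ∀ n, Measurable (ρ n)) (hlip : ∀ n x, lipConst (en n) x ≤ ρ n x) {P : ℝ≥0∞}
    {c : ℕ → ℝ≥0∞} (hc : Tendsto c atTop (𝓝 0)) (hρP : ∀ n, ∫⁻ x, ρ n x ∂μ ≤ P + c n)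
    {l : Filter ℕ} [l.NeBot] (hl : l ≤ atTop) (hν : VagueLim μ ρ l ν)
    {S : Set X} (hS : S.Nonempty) (hSb : Bornology.IsBounded S) {r : ℝ} (hr : 0 < r) :
    tvOpen μ (fun x => 1 - (1 - cutoffNear S r x) * (1 - E.indicator (fun _ => (1 : ℝ)) x)) univ
      + ν S ≤ P + (ENNReal.ofReal r)⁻¹ * μ ({x | infDist x S ≤ r} \ E) := by
  set ψ := cutoffNear S r with hψdef
  set N := {x | infDist x S ≤ r} with hN
  have hψ0 : ∀ x, 0 ≤ ψ x := fun x => clamp01_nonneg _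
  have hψ1 : ∀ x, ψ x ≤ 1 := fun x => clamp01_le_one _
  have hψL : LipschitzWith (Real.toNNReal r⁻¹) ψ := by
    have : LipschitzWith (Real.toNNReal r⁻¹) fun x => 1 - infDist x S / r :=
      LipschitzWith.of_dist_le_mul fun x y => by
        rw [Real.dist_eq, sub_sub_sub_cancel_left, ← sub_div, abs_div, abs_of_pos hr,
          div_eq_inv_mul,
          Real.coe_toNNReal _ (by positivity), abs_sub_comm]
        gcongr
        simpa [Real.dist_eq] using (lipschitz_infDist_pt S).dist_le_mul x y
    have h := lipschitzWith_clamp01.comp this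
    rwa [one_mul] at h
  have hψN : ∀ x ∉ N, ψ x = 0 := fun x hx => by
    refine clamp01_of_nonpos ?_
    rw [hN, mem_ofPred_eq, not_le] at hx
    rw [sub_nonpos, le_div_iff₀ hr]
    linarith
  have hNc : IsCompact N := by
    refine Metric.isCompact_of_isClosed_isBounded
      (isClosed_le (continuous_infDist_pt S) continuous_const) ?_
    refine (hSb.cthickening (δ := r)).subset fun x hx => ?_
    exact (ENNReal.le_ofReal_iff_toReal_le (infEDist_ne_top hS) hr.le).2 hx
  have hcs : HasCompactSupport ψ := HasCompactSupport.intro hNc hψN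
  have hψc := hψL.continuous
  let hn : ℕ → X → ℝ := fun n x => 1 - (1 - ψ x) * (1 - en n x)
  have hhn : ∀ n, LocLipOn univ (hn n) := fun n =>
    (((LipschitzWith.locLipOn hψL univ).const_sub 1).mul ((hen n).const_sub 1)).const_sub 1
  have hhlim : TendstoL1loc μ univ hn
      (fun x => 1 - (1 - ψ x) * (1 - E.indicator (fun _ => (1 : ℝ)) x)) := by
    intro K hK hKu
    refine tendsto_of_tendsto_of_tendsto_of_le_of_le tendsto_const_nhds (hlim K hK hKu)
      (fun _ => zero_le) fun n => lintegral_mono fun x => ENNReal.ofReal_le_ofReal ?_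
    have : hn n x - (1 - (1 - ψ x) * (1 - E.indicator (fun _ => (1 : ℝ)) x)) =
        (1 - ψ x) * (en n x - E.indicator (fun _ => (1 : ℝ)) x) := by simp only [hn]; ring
    rw [this, abs_mul, abs_of_nonneg (sub_nonneg.2 (hψ1 x))]
    exact mul_le_of_le_one_left (abs_nonneg _) (by linarith [hψ0 x])
  have hslope : ∀ n x, lipConst (hn n) x ≤ ρ n x * ENNReal.ofReal (1 - ψ x) +
      (ENNReal.ofReal r)⁻¹ * N.indicator (fun x => ENNReal.ofReal |1 - en n x|) x := by
    intro n x
    rw [show hn n = fun x => 1 - (1 - ψ x) * (1 - en n x) from rfl, lipConst_const_sub]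
    refine (lipConst_mul_le (φ := fun x => 1 - ψ x) (by fun_prop) ?_).trans ?_
    · rw [lipConst_const_sub]
      exact (hen n).lipConst_ne_top isOpen_univ (mem_univ x)
    · rw [lipConst_const_sub, lipConst_const_sub, abs_of_nonneg (sub_nonneg.2 (hψ1 x)), mul_comm]
      refine add_le_add (mul_le_mul_left (hlip n x) _) ?_
      by_cases hx : x ∈ N
      · rw [indicator_of_mem hx, ← ENNReal.ofReal_inv_of_pos hr]
        refine mul_le_mul_left ?_ _
        exact lipConst_le_of_lipschitzWith hψL x
      · rw [lipConst_eq_zero_of_eventuallyEq_const (c := 0), zero_mul]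
        · exact zero_le
        · filter_upwards [hNc.isClosed.isOpen_compl.mem_nhds hx] with y hy using hψN y hy
  have henm := fun n => (hen n).continuous.measurable
  have hi : Measurable (E.indicator fun _ => (1 : ℝ)) := measurable_const.indicator hE
  have hineq : ∀ n, ∫⁻ x, lipConst (hn n) x ∂μ + ∫⁻ x, ρ n x * ENNReal.ofReal (ψ x) ∂μ ≤
      P + c n + (ENNReal.ofReal r)⁻¹ * (μ (N \ E) +
        ∫⁻ x in N, ENNReal.ofReal |en n x - E.indicator (fun _ => (1 : ℝ)) x| ∂μ) := by
    intro n
    have m1 : Measurable fun x => ρ n x * ENNReal.ofReal (ψ x) :=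
      (hρ n).mul hψc.measurable.ennreal_ofReal
    have m2 : Measurable fun x => ENNReal.ofReal |1 - en n x| := by
      have := henm n; fun_prop
    calc ∫⁻ x, lipConst (hn n) x ∂μ + ∫⁻ x, ρ n x * ENNReal.ofReal (ψ x) ∂μ
        = ∫⁻ x, (lipConst (hn n) x + ρ n x * ENNReal.ofReal (ψ x)) ∂μ :=
          (lintegral_add_right _ m1).symm
      _ ≤ ∫⁻ x, (ρ n x + (ENNReal.ofReal r)⁻¹ *
            N.indicator (fun x => ENNReal.ofReal |1 - en n x|) x) ∂μ := by
          refine lintegral_mono fun x => ?_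
          refine (add_le_add_left (hslope n x) _).trans (le_of_eq ?_)
          rw [add_right_comm, ← mul_add, ← ENNReal.ofReal_add (sub_nonneg.2 (hψ1 x)) (hψ0 x)]
          simp
      _ = ∫⁻ x, ρ n x ∂μ + (ENNReal.ofReal r)⁻¹ * ∫⁻ x in N, ENNReal.ofReal |1 - en n x| ∂μ := by
          rw [lintegral_add_left (hρ n), lintegral_const_mul _ (m2.indicator hNc.measurableSet),
            lintegral_indicator hNc.measurableSet]
      _ ≤ _ := by
          refine add_le_add (hρP n) (mul_le_mul_right ?_ _)
          refine (lintegral_triangle (f := fun _ => 1) measurable_const hi).trans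
            (add_le_add (le_of_eq ?_) (by simp only [abs_sub_comm]; exact le_rfl))
          rw [← lintegral_inter_add_sdiff _ _ hE]
          have e1 :
              ∫⁻ x in N ∩ E, ENNReal.ofReal |1 - E.indicator (fun _ => (1 : ℝ)) x| ∂μ = 0 := by
            rw [setLIntegral_congr_fun (g := fun _ => 0) (hNc.measurableSet.inter hE)]
            · simp
            · intro x hx; simp [hx.2]
          have e2 : ∫⁻ x in N \ E, ENNReal.ofReal |1 - E.indicator (fun _ => (1 : ℝ)) x| ∂μ =
              μ (N \ E) := by
            rw [setLIntegral_congr_fun (g := fun _ => 1) (hNc.measurableSet.diff hE)]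
            · simp
            · intro x hx; simp [hx.2]
          rw [e1, e2, zero_add]
  have hR : Tendsto (fun n => P + c n + (ENNReal.ofReal r)⁻¹ * (μ (N \ E) +
        ∫⁻ x in N, ENNReal.ofReal |en n x - E.indicator (fun _ => (1 : ℝ)) x| ∂μ)) l
      (𝓝 (P + (ENNReal.ofReal r)⁻¹ * μ (N \ E))) := by
    have h1 := (tendsto_const_nhds (x := P)).add (hc.mono_left hl)
    have h2 := ENNReal.Tendsto.const_mul (a := (ENNReal.ofReal r)⁻¹)
      ((tendsto_const_nhds (x := μ (N \ E))).add
      ((hlim N hNc (subset_univ _)).mono_left hl)) (Or.inr (by simp [hr]))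
    simpa using h1.add h2
  have hνS : ν S ≤ ∫⁻ x, ENNReal.ofReal (ψ x) ∂ν := by
    calc ν S ≤ ν (closure S) := measure_mono subset_closure
      _ = ∫⁻ x, (closure S).indicator 1 x ∂ν := (lintegral_indicator_one measurableSet_closure).symm
      _ ≤ _ := by
        refine lintegral_mono fun x => ?_
        by_cases hx : x ∈ closure S
        · have : ψ x = 1 := clamp01_of_one_le (by
            rw [(mem_closure_iff_infDist_zero hS).1 hx]; simp)
          simp [hx, this]
        · simp [hx]
  refine (add_le_add_right hνS _).trans ?_
  have hψlim := hν ψ hψc hψ0 hcs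
  set T := tvOpen μ (fun x => 1 - (1 - ψ x) * (1 - E.indicator (fun _ => (1 : ℝ)) x)) univ
  have hstep : ∀ a, (a < T ∨ a = 0) →
      a + ∫⁻ x, ENNReal.ofReal (ψ x) ∂ν ≤ P + (ENNReal.ofReal r)⁻¹ * μ (N \ E) := by
    intro a ha
    have hev : ∀ᶠ n in l, a ≤ ∫⁻ x in univ, lipConst (hn n) x ∂μ := by
      rcases ha with ha | rfl
      · exact hl ((eventually_lt_of_lt_liminf
          (ha.trans_le (tvOpen_le_liminf hhn hhlim))).mono fun _ h => h.le)
      · exact Eventually.of_forall fun _ => zero_le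
    refine le_of_tendsto_of_tendsto ((tendsto_const_nhds (x := a)).add hψlim) hR ?_
    filter_upwards [hev] with n hn
    rw [Measure.restrict_univ] at hn
    exact (add_le_add_left hn _).trans (hineq n)
  have hI : ∫⁻ x, ENNReal.ofReal (ψ x) ∂ν ≤ P + (ENNReal.ofReal r)⁻¹ * μ (N \ E) := by
    simpa using hstep 0 (Or.inr rfl)
  by_cases hIt : ∫⁻ x, ENNReal.ofReal (ψ x) ∂ν = ⊤
  · rw [hIt, top_le_iff] at hI
    rw [hI]
    exact le_top
  rw [← tsub_add_cancel_of_le hI]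
  gcongr
  exact le_of_forall_lt_imp_le_of_dense fun a ha =>
    ENNReal.le_sub_of_add_le_right hIt (hstep a (Or.inl ha))

end DensityPoints

lemma measure_diff_le_mul_of_lt_div {X : Type*} [MeasurableSpace X] {μ : Measure X}
    {E : Set X} (hE : MeasurableSet E) {B : Set X}
    (h0 : μ B ≠ 0) (hfin : μ B ≠ ⊤) {η : ℝ≥0∞} (h : 1 - η < μ (E ∩ B) / μ B) :
    μ (B \ E) ≤ η * μ B := by
  have h1 : (1 - η) * μ B ≤ μ (B ∩ E) := by
    rw [inter_comm]
    exact (ENNReal.le_div_iff_mul_le (Or.inl h0) (Or.inl hfin)).1 h.le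
  have h2 := measure_inter_add_sdiff (μ := μ) B hE
  have hfin' : μ (B ∩ E) ≠ ⊤ := ne_top_of_le_ne_top hfin (measure_mono inter_subset_left)
  refine (ENNReal.add_le_add_iff_left hfin').1 ?_
  rw [h2]
  calc μ B ≤ ((1 - η) + η) * μ B := le_mul_of_one_le_left zero_le le_tsub_add
    _ = (1 - η) * μ B + η * μ B := add_mul _ _ _
    _ ≤ μ (B ∩ E) + η * μ B := by gcongr

section DensityPoints

variable {X : Type*} [MetricSpace X]

lemma continuous_cutoffNear (S : Set X) (r : ℝ) : Continuous (cutoffNear S r) :=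
  lipschitzWith_clamp01.continuous.comp
    (continuous_const.sub ((continuous_infDist_pt S).div_const r))

variable [MeasurableSpace X] [BorelSpace X]

lemma vagueLim_measure_le_of_density {μ ν : Measure X} [IsLocallyFiniteMeasure μ] [ProperSpace X]
    {C : ℝ≥0} (hD : Doubling μ C) (hμ : μ ≠ 0)
    {CP lam : ℝ} (hlam : 1 ≤ lam) (hP : WeakPoincare μ CP lam) {E : Set X}
    (hE : MeasurableSet E) (hPfin : tvOpen μ (E.indicator fun _ => (1 : ℝ)) univ ≠ ⊤)
    {en : ℕ → X → ℝ} (hen : ∀ n, LocLipOn univ (en n))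
    (hlim : TendstoL1loc μ univ en (E.indicator fun _ => (1 : ℝ))) {ρ : ℕ → X → ℝ≥0∞}
    (hρ : ∀ n, Measurable (ρ n)) (hlip : ∀ n x, lipConst (en n) x ≤ ρ n x)
    {c : ℕ → ℝ≥0∞} (hc : Tendsto c atTop (𝓝 0))
    (hρP : ∀ n, ∫⁻ x, ρ n x ∂μ ≤ tvOpen μ (E.indicator fun _ => (1 : ℝ)) univ + c n)
    {l : Filter ℕ} [l.NeBot] (hl : l ≤ atTop) (hν : VagueLim μ ρ l ν) (hfin : ν univ ≠ ⊤)
    {k' : ℕ} (hk' : 24 * lam + 1 ≤ 2 ^ k') {δ : ℝ} (hδ : 0 < δ)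
    (hδ1 : δ ≤ 1) {k : ℕ} (hk : 10 ≤ 2 ^ k * (6 * δ)) {η : ℝ≥0∞} (hη : η * (C : ℝ≥0∞) ^ k ≤ 2⁻¹)
    {S : Set X} (hSb : Bornology.IsBounded S) {R : ℝ} (hR : 0 < R)
    (hdens : ∀ x ∈ S, ∀ t, 0 < t → t < R → μ (ball x t \ E) ≤ η * μ (ball x t)) :
    ν S ≤ ENNReal.ofReal (6 * CP * δ) * ((C : ℝ≥0∞) ^ k' * ν univ) := by
  rcases S.eq_empty_or_nonempty with rfl | hS
  · simp
  set B := ENNReal.ofReal (6 * CP * δ) * ((C : ℝ≥0∞) ^ k' * ν univ) with hB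
  have hBfin : B ≠ ⊤ := by finiteness
  set P := tvOpen μ (E.indicator fun _ => (1 : ℝ)) univ with hPdef
  let r : ℕ → ℝ := fun j => R / 16 * (1 / ((j : ℝ) + 1))
  have hr : ∀ j, 0 < r j := fun j => by positivity
  have hrR : ∀ j, 8 * r j < R := fun j => by
    have : 1 / ((j : ℝ) + 1) ≤ 1 := by
      rw [div_le_one (by positivity)]; linarith [(Nat.cast_nonneg j : (0 : ℝ) ≤ j)]
    have : r j ≤ R / 16 := mul_le_of_le_one_right (by positivity) this
    linarith
  have hnb : ∀ j, μ ({x | infDist x S ≤ r j} \ E) ≤ ENNReal.ofReal (r j) * B := fun j =>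
    measure_neighborhood_diff_le hD hμ hlam hP hE hen hlim hlip hl hν hk' hδ hδ1 hk hη hS hdens
      (hr j) (hrR j)
  let u : ℕ → X → ℝ := fun j x =>
    1 - (1 - cutoffNear S (r j) x) * (1 - E.indicator (fun _ => (1 : ℝ)) x)
  have hi : Measurable (E.indicator fun _ => (1 : ℝ)) := measurable_const.indicator hE
  have hsum : ∀ j, tvOpen μ (u j) univ + ν S ≤ P + B := fun j => by
    refine (tvOpen_add_measure_le hE hen hlim hρ hlip hc hρP hl hν hS hSb (hr j)).trans ?_
    gcongr
    calc (ENNReal.ofReal (r j))⁻¹ * μ ({x | infDist x S ≤ r j} \ E)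
        ≤ (ENNReal.ofReal (r j))⁻¹ * (ENNReal.ofReal (r j) * B) := by gcongr; exact hnb j
      _ = B := by
        rw [← mul_assoc, ENNReal.inv_mul_cancel (by simp [hr j]) ENNReal.ofReal_ne_top, one_mul]
  have hνSfin : ν S ≠ ⊤ := ne_top_of_le_ne_top hfin (measure_mono (subset_univ S))
  have hr0 : Tendsto (fun j => ENNReal.ofReal (r j) * B) atTop (𝓝 0) := by
    have h1 : Tendsto r atTop (𝓝 0) := by
      simpa [r] using (tendsto_one_div_add_atTop_nhds_zero_nat (𝕜 := ℝ)).const_mul (R / 16)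
    have h2 := ENNReal.Tendsto.mul_const (b := B) (ENNReal.tendsto_ofReal h1) (Or.inr hBfin)
    simpa using h2
  have hulim : TendstoL1loc μ univ u (E.indicator fun _ => (1 : ℝ)) := by
    intro K _ _
    refine tendsto_of_tendsto_of_tendsto_of_le_of_le tendsto_const_nhds hr0
      (fun _ => zero_le) fun j => le_trans ?_ (hnb j)
    have hm : MeasurableSet ({x | infDist x S ≤ r j} \ E) :=
      (isClosed_le (continuous_infDist_pt S) continuous_const).measurableSet.diff hE
    refine (setLIntegral_le_lintegral _ _).trans ?_
    rw [← lintegral_indicator_one hm]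
    refine lintegral_mono fun x => ?_
    by_cases hxE : x ∈ E
    · simp [u, hxE]
    by_cases hx : infDist x S ≤ r j
    · rw [indicator_of_mem (show x ∈ {x | infDist x S ≤ r j} \ E from ⟨hx, hxE⟩)]
      have h0 := clamp01_nonneg (1 - infDist x S / r j)
      have h1 := clamp01_le_one (1 - infDist x S / r j)
      simp only [u, hxE, not_false_eq_true, indicator_of_notMem, sub_zero, mul_one,
        sub_sub_cancel, Pi.one_apply, ENNReal.ofReal_le_one, cutoffNear, abs_le]
      constructor <;> linarith
    · have : cutoffNear S (r j) x = 0 := by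
        refine clamp01_of_nonpos ?_
        rw [sub_nonpos, le_div_iff₀ (hr j)]
        linarith
      simp [u, hxE, this]
  have hlsc : P ≤ P + B - ν S := by
    refine tvOpen_univ_le_of_tendsto (fun j => ?_) hulim fun j =>
      ENNReal.le_sub_of_add_le_right hνSfin (hsum j)
    have := (continuous_cutoffNear S (r j)).measurable
    fun_prop
  have hle : ν S ≤ P + B := le_add_self.trans (hsum 0)
  have := add_le_add_left hlsc (ν S)
  rw [tsub_add_cancel_of_le hle] at this
  exact (ENNReal.add_le_add_iff_left hPfin).1 this

/-- If the slopes of approximations of `1_E` have optimal total mass in the limit, then the limit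
measure does not charge the essential interior of `E`. -/
lemma vagueLim_essInt_eq_zero {μ ν : Measure X} [IsLocallyFiniteMeasure μ] [ProperSpace X]
    {C : ℝ≥0} (hD : Doubling μ C) (hμ : μ ≠ 0)
    {CP lam : ℝ} (hlam : 1 ≤ lam) (hP : WeakPoincare μ CP lam) {E : Set X}
    (hE : MeasurableSet E) (hPfin : tvOpen μ (E.indicator fun _ => (1 : ℝ)) univ ≠ ⊤)
    {en : ℕ → X → ℝ} (hen : ∀ n, LocLipOn univ (en n))
    (hlim : TendstoL1loc μ univ en (E.indicator fun _ => (1 : ℝ))) {ρ : ℕ → X → ℝ≥0∞}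
    (hρ : ∀ n, Measurable (ρ n)) (hlip : ∀ n x, lipConst (en n) x ≤ ρ n x)
    {c : ℕ → ℝ≥0∞} (hc : Tendsto c atTop (𝓝 0))
    (hρP : ∀ n, ∫⁻ x, ρ n x ∂μ ≤ tvOpen μ (E.indicator fun _ => (1 : ℝ)) univ + c n)
    {l : Filter ℕ} [l.NeBot] (hl : l ≤ atTop) (hν : VagueLim μ ρ l ν) (hfin : ν univ ≠ ⊤) :
    ν (essInt μ E) = 0 := by
  rcases isEmpty_or_nonempty X with hX | ⟨⟨x₀⟩⟩
  · rw [Set.eq_empty_of_isEmpty (essInt μ E), measure_empty]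
  obtain ⟨k', hk'⟩ := pow_unbounded_of_one_lt (24 * lam + 1) (one_lt_two (α := ℝ))
  have hδ : ∀ δ : ℝ, 0 < δ → δ ≤ 1 →
      ν (essInt μ E) ≤ ENNReal.ofReal (6 * CP * δ) * ((C : ℝ≥0∞) ^ k' * ν univ) := by
    intro δ hδ hδ1
    obtain ⟨k, hk⟩ := pow_unbounded_of_one_lt (10 / (6 * δ)) (one_lt_two (α := ℝ))
    rw [div_lt_iff₀ (by positivity)] at hk
    set η : ℝ≥0∞ := 2⁻¹ / (C : ℝ≥0∞) ^ k with hη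
    have hη0 : η ≠ 0 := (ENNReal.div_pos (by simp) (by simp)).ne'
    let S : ℕ → Set X := fun j => {x | x ∈ ball x₀ j ∧ ∀ t, 0 < t → t < 1 / ((j : ℝ) + 1) →
      μ (ball x t \ E) ≤ η * μ (ball x t)}
    have hSmono : Monotone S := by
      intro i j hij x hx
      have hij' : (i : ℝ) ≤ j := by exact_mod_cast hij
      refine ⟨ball_subset_ball hij' hx.1, fun t h0 ht => hx.2 t h0 (ht.trans_le ?_)⟩
      gcongr
    have hcov : essInt μ E ⊆ ⋃ j, S j := by
      intro x hx
      have hlt : (1 : ℝ≥0∞) - η < 1 := ENNReal.sub_lt_self (by simp) (by simp) hη0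
      have hev := (show Tendsto _ _ _ from hx).eventually (lt_mem_nhds hlt)
      rw [eventually_nhdsWithin_iff] at hev
      obtain ⟨τ, hτ, hτ'⟩ := Metric.eventually_nhds_iff.1 hev
      obtain ⟨j₁, hj₁⟩ := exists_nat_one_div_lt hτ
      obtain ⟨j₂, hj₂⟩ := exists_nat_gt (dist x x₀)
      refine mem_iUnion.2 ⟨max j₁ j₂, ?_, fun t h0 ht => ?_⟩
      · rw [mem_ball]
        refine hj₂.trans_le ?_
        exact_mod_cast le_max_right j₁ j₂
      · refine measure_diff_le_mul_of_lt_div hE (hD.ball_pos hμ x h0).ne' (hD.ball_lt_top x t).ne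
          (hτ' ?_ h0)
        rw [Real.dist_eq, sub_zero, abs_of_pos h0]
        refine (ht.trans_le ?_).trans hj₁
        have : (j₁ : ℝ) ≤ (max j₁ j₂ : ℕ) := by exact_mod_cast le_max_left j₁ j₂
        gcongr
    refine (measure_mono hcov).trans ?_
    rw [hSmono.measure_iUnion]
    refine iSup_le fun j => ?_
    refine vagueLim_measure_le_of_density hD hμ hlam hP hE hPfin hen hlim hρ hlip hc hρP hl hν hfin
      hk'.le hδ hδ1 hk.le (η := η) ?_ (isBounded_ball.subset fun x hx => hx.1)
      (R := 1 / ((j : ℝ) + 1)) (by positivity) fun x hx => hx.2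
    exact ENNReal.mul_le_of_le_div le_rfl
  have hlim0 : Tendsto (fun δ : ℝ => ENNReal.ofReal (6 * CP * δ) * ((C : ℝ≥0∞) ^ k' * ν univ))
      (𝓝[>] 0) (𝓝 0) := by
    have h1 : Tendsto (fun δ : ℝ => 6 * CP * δ) (𝓝[>] 0) (𝓝 (6 * CP * 0)) :=
      (tendsto_id.mono_left nhdsWithin_le_nhds).const_mul _
    have h2 := ENNReal.Tendsto.mul_const (b := (C : ℝ≥0∞) ^ k' * ν univ)
      (ENNReal.tendsto_ofReal h1) (Or.inr (by finiteness))
    simpa using h2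
  refine le_antisymm (ge_of_tendsto hlim0 ?_) zero_le
  filter_upwards [Ioc_mem_nhdsGT (zero_lt_one (α := ℝ))] with δ hd using hδ δ hd.1 hd.2

end DensityPoints

section Decomposable

variable {X : Type*} [MetricSpace X] [MeasurableSpace X] [BorelSpace X]

/-- If `E` splits into `F` and `G` with additive perimeter, then `F` has no perimeter in the
essential interior of `E`. -/
lemma tv_essInt_eq_zero_of_additive {μ : Measure X} [IsLocallyFiniteMeasure μ] [ProperSpace X]
    {C : ℝ≥0} (hD : Doubling μ C) (hμ : μ ≠ 0)
    {CP lam : ℝ} (hlam : 1 ≤ lam) (hP : WeakPoincare μ CP lam) {E F G : Set X}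
    (hE : FinPerim μ E) (hF : FinPerim μ F) (hG : FinPerim μ G) (hFG : Disjoint F G)
    (hU : F ∪ G = E) (hadd : perim μ E univ = perim μ F univ + perim μ G univ) :
    tv μ (F.indicator fun _ => (1 : ℝ)) (essInt μ E) = 0 := by
  obtain ⟨hEm, hEp⟩ := hE
  obtain ⟨hFm, hFp⟩ := hF
  obtain ⟨hGm, hGp⟩ := hG
  simp only [perim, tv_univ] at hEp hFp hGp hadd
  obtain ⟨fn, f1, f2, f3⟩ := exists_approx_seq hFp.ne
  obtain ⟨gn, g1, g2, g3⟩ := exists_approx_seq hGp.ne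
  have hsum : ∀ x, E.indicator (fun _ => (1 : ℝ)) x =
      F.indicator (fun _ => (1 : ℝ)) x + G.indicator (fun _ => (1 : ℝ)) x := fun x => by
    rw [← hU, indicator_union_of_disjoint hFG]
  let ρ : ℕ → X → ℝ≥0∞ := fun n x => lipConst (fn n) x + lipConst (gn n) x
  have mf := fun n => measurable_lipConst (f1 n).continuous
  have hρm : ∀ n, Measurable (ρ n) := fun n => (mf n).add (measurable_lipConst (g1 n).continuous)
  let c : ℕ → ℝ≥0∞ := fun n => ((n : ℝ≥0∞) + 1)⁻¹ + ((n : ℝ≥0∞) + 1)⁻¹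
  have h0 : Tendsto (fun n : ℕ => ((n : ℝ≥0∞) + 1)⁻¹) atTop (𝓝 0) := by
    simpa [Function.comp_def] using
      ENNReal.tendsto_inv_nat_nhds_zero.comp (tendsto_add_atTop_nat 1)
  have hc : Tendsto c atTop (𝓝 0) := by simpa using h0.add h0
  have hρP : ∀ n, ∫⁻ x, ρ n x ∂μ ≤ tvOpen μ (E.indicator fun _ => (1 : ℝ)) univ + c n := by
    intro n
    rw [lintegral_add_left (mf n), hadd]
    refine (add_le_add (f3 n) (g3 n)).trans (le_of_eq ?_)
    simp only [c]; ring
  have hlimE : TendstoL1loc μ univ (fun n x => fn n x + gn n x)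
      (E.indicator fun _ => (1 : ℝ)) := by
    intro K hK hu
    have := (f2 K hK hu).add (g2 K hK hu)
    rw [add_zero] at this
    refine tendsto_of_tendsto_of_tendsto_of_le_of_le tendsto_const_nhds this
      (fun _ => zero_le) fun n => ?_
    have m1 := (f1 n).continuous.measurable
    have m2 : Measurable (F.indicator fun _ => (1 : ℝ)) := measurable_const.indicator hFm
    dsimp only
    rw [← lintegral_add_left (by fun_prop)]
    refine lintegral_mono fun x => ?_
    rw [← ENNReal.ofReal_add (abs_nonneg _) (abs_nonneg _), hsum, add_sub_add_comm]
    exact ENNReal.ofReal_le_ofReal (abs_add_le _ _)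
  have hM : tvOpen μ (E.indicator fun _ => (1 : ℝ)) univ + 2 ≠ ⊤ := by finiteness
  obtain ⟨ν, hνM, hν⟩ := exists_vagueLim hρm
    (M := (tvOpen μ (E.indicator fun _ => (1 : ℝ)) univ + 2).toNNReal) fun n => by
      rw [ENNReal.coe_toNNReal hM]
      refine (hρP n).trans ?_
      have : ((n : ℝ≥0∞) + 1)⁻¹ ≤ 1 := by simp
      gcongr
      calc c n ≤ 1 + 1 := add_le_add this this
        _ = 2 := one_add_one_eq_two
  have hfin : ν univ ≠ ⊤ := ne_top_of_le_ne_top ENNReal.coe_ne_top hνM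
  have hzero := vagueLim_essInt_eq_zero hD hμ hlam hP hEm hEp.ne
    (fun n => (f1 n).add (g1 n)) hlimE hρm (fun n x => lipConst_add_le _ _ x) hc hρP
    Nat.hyperfilter_le_atTop hν hfin
  have : IsFiniteMeasure ν := ⟨hfin.lt_top⟩
  refine le_antisymm (le_of_forall_gt fun ε hε => ?_) zero_le
  obtain ⟨Ω, hsub, hΩ, hΩε⟩ := (essInt μ E).exists_isOpen_lt_of_lt ε (μ := ν) (by rwa [hzero])
  refine lt_of_le_of_lt ?_ hΩε
  refine (tv_le_tvOpen hΩ hsub).trans ?_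
  exact tvOpen_le_of_vagueLim (measurable_const.indicator hFm) f1 f2 hρm
    (fun n x => le_self_add) Nat.hyperfilter_le_atTop hν hfin hΩ

/-- A set of finite perimeter on which functions with vanishing variation in the essential
interior are constant is indecomposable. -/
lemma indecomposable_of_forall_const {μ : Measure X} [CompleteSpace X]
    [TopologicalSpace.SeparableSpace X] [IsLocallyFiniteMeasure μ] (hμ : μ ≠ 0) (hPI : IsPI μ)
    {E : Set X} (hE : FinPerim μ E)
    (h : ∀ f : X → ℝ, LocallyIntegrable f μ → tv μ f univ < ⊤ → tv μ f (essInt μ E) = 0 →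
      ∃ t : ℝ, ∀ᵐ x ∂(μ.restrict E), f x = t) : Indecomposable μ E := by
  obtain ⟨C, CP, lam, hD, -, hlam, hP⟩ := hPI
  have := hD.properSpace hμ
  refine ⟨hE, ?_⟩
  rintro ⟨F, G, hF, hG, hFG, hU, hF0, hG0, hadd⟩
  rw [inter_univ] at hU
  obtain ⟨t, ht⟩ := h (F.indicator fun _ => (1 : ℝ))
    ((locallyIntegrable_const (1 : ℝ)).indicator hF.1) hF.2
    (tv_essInt_eq_zero_of_additive hD hμ hlam hP hE hF hG hFG hU hadd)
  have key : ∀ A ⊆ E, MeasurableSet A → 0 < μ A →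
      ∃ x ∈ A, F.indicator (fun _ => (1 : ℝ)) x = t := by
    intro A hA hAm hA0
    have h1 := ae_restrict_of_ae_restrict_of_subset hA ht
    by_contra! hne
    refine hA0.ne' (measure_mono_null (fun x hx => ?_) ((ae_restrict_iff' hAm).1 h1))
    exact fun h => hne x hx (h hx)
  obtain ⟨x, hx, hxt⟩ := key F (hU ▸ subset_union_left) hF.1 hF0
  obtain ⟨y, hy, hyt⟩ := key G (hU ▸ subset_union_right) hG.1 hG0
  rw [indicator_of_mem hx] at hxt
  rw [indicator_of_notMem (fun hyF => hFG.le_bot ⟨hyF, hy⟩)] at hyt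
  exact one_ne_zero (hxt.trans hyt.symm)

end Decomposable

section CodimensionOne

variable {X : Type*} [MetricSpace X] [MeasurableSpace X]

lemma preH_le {μ : Measure X} {δ : ℝ} {S : Set X} {c : ℕ → X × ℝ}
    (hc : ∀ i, 0 < (c i).2 ∧ (c i).2 ≤ δ) (hS : S ⊆ ⋃ i, ball (c i).1 (c i).2) :
    preH μ δ S ≤ ∑' i, μ (ball (c i).1 (c i).2) / ENNReal.ofReal (2 * (c i).2) :=
  iInf_le_of_le c (iInf_le_of_le hc (iInf_le_of_le hS le_rfl))

lemma exists_cover_of_preH_lt {μ : Measure X} {δ : ℝ} {S : Set X} {a : ℝ≥0∞}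
    (h : preH μ δ S < a) : ∃ c : ℕ → X × ℝ, (∀ i, 0 < (c i).2 ∧ (c i).2 ≤ δ) ∧
      S ⊆ ⋃ i, ball (c i).1 (c i).2 ∧
      ∑' i, μ (ball (c i).1 (c i).2) / ENNReal.ofReal (2 * (c i).2) < a := by
  simpa only [preH, iInf_lt_iff, exists_prop] using h

lemma preH_le_codimH {μ : Measure X} {δ : ℝ} (hδ : 0 < δ) (S : Set X) :
    preH μ δ S ≤ codimH μ S :=
  le_iSup₂_of_le δ hδ le_rfl

lemma preH_mono {μ : Measure X} {δ : ℝ} {S T : Set X} (h : S ⊆ T) :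
    preH μ δ S ≤ preH μ δ T :=
  le_iInf fun _ => le_iInf fun hc => le_iInf fun hT => preH_le hc (h.trans hT)

lemma codimH_mono {μ : Measure X} {S T : Set X} (h : S ⊆ T) : codimH μ S ≤ codimH μ T :=
  iSup₂_mono fun _ _ => preH_mono h

lemma preH_iUnion_le {μ : Measure X} {δ : ℝ} (S : ℕ → Set X) :
    preH μ δ (⋃ n, S n) ≤ ∑' n, preH μ δ (S n) := by
  refine ENNReal.le_of_forall_pos_le_add fun ε hε hfin => ?_
  obtain ⟨ε', hε', hsum⟩ := ENNReal.exists_pos_sum_of_countable (ENNReal.coe_ne_zero.2 hε.ne') ℕ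
  have := fun n => exists_cover_of_preH_lt (ENNReal.lt_add_right
    (ENNReal.ne_top_of_tsum_ne_top hfin.ne n) (ENNReal.coe_ne_zero.2 (hε' n).ne'))
  choose c hc hcov hlt using this
  let e := Nat.pairEquiv.symm
  refine (preH_le (c := fun i => c (e i).1 (e i).2) (fun i => hc _ _) fun x hx => ?_).trans ?_
  · obtain ⟨n, hn⟩ := mem_iUnion.1 hx
    obtain ⟨i, hi⟩ := mem_iUnion.1 (hcov n hn)
    exact mem_iUnion.2 ⟨e.symm (n, i), by simpa using hi⟩
  · rw [e.tsum_eq (fun p : ℕ × ℕ =>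
      μ (ball (c p.1 p.2).1 (c p.1 p.2).2) / ENNReal.ofReal (2 * (c p.1 p.2).2)),
      ENNReal.tsum_prod']
    refine (ENNReal.tsum_le_tsum fun n => (hlt n).le).trans ?_
    rw [ENNReal.tsum_add]
    gcongr

/-- The codimension-one Hausdorff measure as an outer measure, provided it vanishes on `∅`. -/
noncomputable def codimOuter (μ : Measure X) (h0 : codimH μ ∅ = 0) : OuterMeasure X where
  measureOf := codimH μ
  empty := h0
  mono := codimH_mono
  iUnion_nat S _ := iSup₂_le fun _ hδ => (preH_iUnion_le S).trans
    (ENNReal.tsum_le_tsum fun n => preH_le_codimH hδ (S n))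

lemma preH_add_preH_le {μ : Measure X} {δ : ℝ} (h0 : preH μ δ ∅ = 0) {S T : Set X} {r : ℝ}
    (hr : ∀ x ∈ S, ∀ y ∈ T, r ≤ dist x y) {δ' : ℝ} (hδ' : δ' ≤ δ) (hδr : 2 * δ' ≤ r) :
    preH μ δ S + preH μ δ T ≤ preH μ δ' (S ∪ T) := by
  classical
  refine le_iInf fun c => le_iInf fun hc => le_iInf fun hcov => ?_
  refine ENNReal.le_of_forall_pos_le_add fun ε hε _ => ?_
  obtain ⟨e, he, -, hsum⟩ := exists_cover_of_preH_lt (μ := μ) (δ := δ) (S := ∅) (a := ε / 2)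
    (by rw [h0]; exact ENNReal.half_pos (by simpa using hε.ne'))
  let w : X × ℝ → ℝ≥0∞ := fun p => μ (ball p.1 p.2) / ENNReal.ofReal (2 * p.2)
  let sel : Set X → ℕ → X × ℝ := fun A i =>
    if (ball (c i).1 (c i).2 ∩ A).Nonempty then c i else e i
  have key : ∀ A ⊆ S ∪ T, preH μ δ A ≤ ∑' i, w (sel A i) := by
    intro A hA
    refine preH_le (fun i => ?_) fun x hx => ?_
    · by_cases h : (ball (c i).1 (c i).2 ∩ A).Nonempty
      · simpa only [sel, if_pos h] using ⟨(hc i).1, (hc i).2.trans hδ'⟩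
      · simpa only [sel, if_neg h] using he i
    · obtain ⟨i, hi⟩ := mem_iUnion.1 (hcov (hA hx))
      refine mem_iUnion.2 ⟨i, ?_⟩
      have : (ball (c i).1 (c i).2 ∩ A).Nonempty := ⟨x, hi, hx⟩
      simpa only [sel, if_pos this] using hi
  calc preH μ δ S + preH μ δ T
      ≤ ∑' i, (w (sel S i) + w (sel T i)) := by
        rw [ENNReal.tsum_add]
        exact add_le_add (key S subset_union_left) (key T subset_union_right)
    _ ≤ ∑' i, (w (c i) + (w (e i) + w (e i))) := by
        refine ENNReal.tsum_le_tsum fun i => ?_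
        by_cases h1 : (ball (c i).1 (c i).2 ∩ S).Nonempty
        · have h2 : ¬ (ball (c i).1 (c i).2 ∩ T).Nonempty := by
            rintro ⟨y, hy, hyT⟩
            obtain ⟨x, hx, hxS⟩ := h1
            have := hr x hxS y hyT
            have h3 := dist_triangle_right x y (c i).1
            rw [mem_ball] at hx hy
            linarith [(hc i).2]
          simp only [sel, if_pos h1, if_neg h2]
          exact add_le_add_right le_self_add _
        · simp only [sel, if_neg h1]
          split_ifs
          · rw [add_comm]; exact add_le_add_right le_self_add _
          · exact le_add_self
    _ = ∑' i, w (c i) + (∑' i, w (e i) + ∑' i, w (e i)) := by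
        rw [ENNReal.tsum_add, ENNReal.tsum_add]
    _ ≤ ∑' i, w (c i) + (ε / 2 + ε / 2) := by gcongr
    _ = ∑' i, w (c i) + ε := by rw [ENNReal.add_halves]

lemma preH_anti {μ : Measure X} {δ δ' : ℝ} (h : δ' ≤ δ) (S : Set X) :
    preH μ δ S ≤ preH μ δ' S :=
  le_iInf fun _ => le_iInf fun hc => le_iInf fun hS =>
    preH_le (fun i => ⟨(hc i).1, (hc i).2.trans h⟩) hS

lemma isMetric_codimOuter {μ : Measure X} (h0 : codimH μ ∅ = 0) :
    (codimOuter μ h0).IsMetric := by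
  rintro S T ⟨r, hr0, hr⟩
  refine le_antisymm (measure_union_le _ _) ?_
  obtain ⟨r', hr'0, hr'⟩ := ENNReal.lt_iff_exists_nnreal_btwn.1 (pos_iff_ne_zero.2 hr0)
  have hr'pos : (0 : ℝ) < r' := by simpa using hr'0
  have hdist : ∀ x ∈ S, ∀ y ∈ T, (r' : ℝ) ≤ dist x y := fun x hx y hy => by
    have := hr'.le.trans (hr x hx y hy)
    rw [edist_nndist, ENNReal.coe_le_coe] at this
    exact_mod_cast this
  change codimH μ S + codimH μ T ≤ codimH μ (S ∪ T)
  refine ENNReal.biSup_add_biSup_le' (p := fun δ : ℝ => 0 < δ) (q := fun δ : ℝ => 0 < δ)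
    ⟨1, one_pos⟩ ⟨1, one_pos⟩ fun δ₁ h₁ δ₂ h₂ => ?_
  set δ := min δ₁ δ₂ with hδ
  have hδ0 : 0 < δ := lt_min h₁ h₂
  have hδ' : 0 < min δ (r' / 2) := lt_min hδ0 (by positivity)
  calc preH μ δ₁ S + preH μ δ₂ T ≤ preH μ δ S + preH μ δ T :=
        add_le_add (preH_anti (min_le_left _ _) S) (preH_anti (min_le_right _ _) T)
    _ ≤ preH μ (min δ (r' / 2)) (S ∪ T) :=
        preH_add_preH_le (le_antisymm ((preH_le_codimH hδ0 ∅).trans h0.le) zero_le) hdist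
          (min_le_left _ _) (by linarith [min_le_right δ ((r' : ℝ) / 2)])
    _ ≤ codimH μ (S ∪ T) := preH_le_codimH hδ' _

lemma codimH_inter_add_diff [BorelSpace X] {μ : Measure X} (h0 : codimH μ ∅ = 0) (S : Set X)
    {A : Set X} (hA : MeasurableSet A) : codimH μ (S ∩ A) + codimH μ (S \ A) = codimH μ S :=
  ((isMetric_codimOuter h0).le_caratheodory A hA S).symm

end CodimensionOne

section EssentialBoundary

variable {X : Type*} [MetricSpace X] [MeasurableSpace X]

lemma upperDens_empty (μ : Measure X) (x : X) : upperDens μ ∅ x = 0 := by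
  simp [upperDens]

lemma essBdry_empty (μ : Measure X) : essBdry μ ∅ = ∅ := by
  ext x
  simp [essBdry, upperDens_empty]

lemma essBdry_compl (μ : Measure X) (A : Set X) : essBdry μ Aᶜ = essBdry μ A := by
  ext x
  simp [essBdry, and_comm]

lemma upperDens_mono {μ : Measure X} {A B : Set X} (h : A ⊆ B) (x : X) :
    upperDens μ A x ≤ upperDens μ B x :=
  limsup_le_limsup (Eventually.of_forall fun r =>
    ENNReal.div_le_div_right (measure_mono (inter_subset_inter_left _ h)) _)

lemma tendsto_zero_of_upperDens {μ : Measure X} {A : Set X} {x : X} (h : upperDens μ A x = 0) :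
    Tendsto (fun r : ℝ => μ (A ∩ ball x r) / μ (ball x r)) (𝓝[>] 0) (𝓝 0) :=
  tendsto_of_le_liminf_of_limsup_le zero_le h.le

lemma upperDens_union_eq_zero {μ : Measure X} {A B : Set X} {x : X} (hA : upperDens μ A x = 0)
    (hB : upperDens μ B x = 0) : upperDens μ (A ∪ B) x = 0 := by
  have h := (tendsto_zero_of_upperDens hA).add (tendsto_zero_of_upperDens hB)
  rw [add_zero] at h
  refine (tendsto_of_tendsto_of_tendsto_of_le_of_le tendsto_const_nhds h (fun _ => zero_le)
    fun r => ?_).limsup_eq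
  rw [union_inter_distrib_right, ← ENNReal.add_div]
  exact ENNReal.div_le_div_right (measure_union_le _ _) _

lemma mem_essInt_of_upperDens_compl [BorelSpace X] {μ : Measure X} [IsLocallyFiniteMeasure μ]
    {C : ℝ≥0} (hD : Doubling μ C) (hμ : μ ≠ 0) {E : Set X} (hE : MeasurableSet E) {x : X}
    (hx : upperDens μ Eᶜ x = 0) : x ∈ essInt μ E := by
  have h2 := ENNReal.Tendsto.sub (tendsto_const_nhds (x := (1 : ℝ≥0∞)) (f := 𝓝[>] (0 : ℝ)))
    (tendsto_zero_of_upperDens hx) (Or.inl ENNReal.one_ne_top)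
  rw [tsub_zero] at h2
  refine h2.congr' ?_
  filter_upwards [self_mem_nhdsWithin] with r hr
  have hfin := (hD.ball_lt_top x r).ne
  have hpos := (hD.ball_pos hμ x hr).ne'
  have hc : μ (Eᶜ ∩ ball x r) / μ (ball x r) ≠ ⊤ :=
    ENNReal.div_ne_top (ne_top_of_le_ne_top hfin (measure_mono inter_subset_right)) hpos
  refine (ENNReal.eq_sub_of_add_eq hc ?_).symm
  rw [← ENNReal.add_div, inter_comm, inter_comm Eᶜ, ← sdiff_eq, measure_inter_add_sdiff _ hE,
    ENNReal.div_self hpos hfin]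

lemma essBdry_inter_diff_subset [BorelSpace X] {μ : Measure X} [IsLocallyFiniteMeasure μ]
    {C : ℝ≥0} (hD : Doubling μ C) (hμ : μ ≠ 0) {E : Set X} (hE : MeasurableSet E) (A : Set X) :
    essBdry μ (E ∩ A) \ essBdry μ E ⊆ essInt μ E ∩ essBdry μ A := by
  rintro x ⟨⟨h1, h2⟩, h3⟩
  have h4 : upperDens μ Eᶜ x = 0 := by
    by_contra h
    exact h3 ⟨h1.trans_le (upperDens_mono inter_subset_left x), pos_iff_ne_zero.2 h⟩
  refine ⟨mem_essInt_of_upperDens_compl hD hμ hE h4,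
    h1.trans_le (upperDens_mono inter_subset_right x), ?_⟩
  rw [compl_inter] at h2
  exact pos_iff_ne_zero.2 fun h5 => h2.ne' (upperDens_union_eq_zero h4 h5)

/-- In a doubling space, positivity of the upper density is detected by dyadic radii. -/
lemma upperDens_pos_iff [BorelSpace X] {μ : Measure X} [IsLocallyFiniteMeasure μ]
    {C : ℝ≥0} (hD : Doubling μ C) (hμ : μ ≠ 0) (E : Set X) (x : X) :
    0 < upperDens μ E x ↔ 0 < limsup (fun k : ℕ =>
      μ (E ∩ ball x ((1 / 2) ^ k)) / μ (ball x ((1 / 2) ^ k))) atTop := by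
  have hC : (C : ℝ≥0∞) ≠ 0 := ENNReal.coe_ne_zero.2 (zero_lt_one.trans_le hD.1).ne'
  constructor
  · contrapose!
    rw [le_zero_iff, le_zero_iff]
    intro h
    have h1 : Tendsto (fun k : ℕ => μ (E ∩ ball x ((1 / 2) ^ k)) / μ (ball x ((1 / 2) ^ k)))
      atTop (𝓝 0) := tendsto_of_le_liminf_of_limsup_le zero_le h.le
    refine (Tendsto.limsup_eq (f := 𝓝[>] (0 : ℝ)) ?_)
    rw [ENNReal.tendsto_nhds_zero] at h1 ⊢
    intro ε hε
    obtain ⟨N, hN⟩ := eventually_atTop.1 (h1 (ε / C)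
      (ENNReal.div_pos hε.ne' ENNReal.coe_ne_top))
    filter_upwards [Ioo_mem_nhdsGT (show (0 : ℝ) < (1 / 2) ^ (N + 1) by positivity)] with r hr
    have hr1 : r ≤ 1 := hr.2.le.trans (pow_le_one₀ (by norm_num) (by norm_num))
    obtain ⟨k, hk1, hk2⟩ := exists_nat_pow_near_of_lt_one hr.1 hr1 (y := (1 / 2 : ℝ))
      (by norm_num) (by norm_num)
    have hNk : N ≤ k := by
      by_contra! hlt
      have : (1 / 2 : ℝ) ^ (N + 1) ≤ (1 / 2) ^ (k + 1) :=
        pow_le_pow_of_le_one (by norm_num) (by norm_num) (by lia)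
      linarith [hr.2]
    have hball : μ (ball x ((1 / 2) ^ k)) ≤ C * μ (ball x r) := by
      refine le_trans ?_ (hD.2 x r hr.1)
      refine measure_mono (ball_subset_ball ?_)
      rw [pow_succ] at hk1
      linarith
    have hpos := fun {s : ℝ} (hs : 0 < s) => (hD.ball_pos hμ x hs).ne'
    refine ENNReal.div_le_of_le_mul ?_
    have h3 := (ENNReal.div_le_iff (hpos (by positivity)) (hD.ball_lt_top x _).ne).1 (hN k hNk)
    calc μ (E ∩ ball x r) ≤ μ (E ∩ ball x ((1 / 2) ^ k)) := by gcongr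
      _ ≤ ε / C * μ (ball x ((1 / 2) ^ k)) := h3
      _ ≤ ε / C * (C * μ (ball x r)) := by gcongr
      _ = ε * μ (ball x r) := by
        rw [← mul_assoc, ENNReal.div_mul_cancel hC ENNReal.coe_ne_top]
  · intro h
    refine h.trans_le ?_
    have ht : Tendsto (fun k : ℕ => (1 / 2 : ℝ) ^ k) atTop (𝓝[>] 0) :=
      tendsto_nhdsWithin_iff.2 ⟨tendsto_pow_atTop_nhds_zero_of_lt_one (by norm_num) (by norm_num),
        Eventually.of_forall fun k => by simp⟩
    exact limsup_le_limsup_of_le (u := fun r : ℝ => μ (E ∩ ball x r) / μ (ball x r)) ht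

lemma measurableSet_essBdry [TopologicalSpace.SeparableSpace X] [BorelSpace X] {μ : Measure X}
    [IsLocallyFiniteMeasure μ] {C : ℝ≥0} (hD : Doubling μ C) (hμ : μ ≠ 0) {E : Set X}
    (hE : MeasurableSet E) : MeasurableSet (essBdry μ E) := by
  have : SecondCountableTopology X := UniformSpace.secondCountable_of_separable X
  have h1 : ∀ A : Set X, MeasurableSet A → ∀ r : ℝ, Measurable fun x => μ (A ∩ ball x r) := by
    intro A hA r
    have hs : MeasurableSet {p : X × X | p.2 ∈ A ∧ dist p.2 p.1 < r} :=
      (measurable_snd hA).inter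
        (measurableSet_lt (measurable_snd.dist measurable_fst) measurable_const)
    exact measurable_measure_prodMk_left hs
  have h2 : ∀ A : Set X, MeasurableSet A → MeasurableSet {x | 0 < upperDens μ A x} := by
    intro A hA
    simp only [upperDens_pos_iff hD hμ]
    refine measurableSet_lt measurable_const (Measurable.limsup fun k => (h1 A hA _).div ?_)
    simpa using h1 univ .univ ((1 / 2) ^ k)
  exact (h2 E hE).inter (h2 Eᶜ hE.compl)

end EssentialBoundary

section Ramp

lemma lipschitzWith_ramp (h : ℝ≥0) (t : ℝ) :
    LipschitzWith h⁻¹ fun s : ℝ => clamp01 ((s - t) / h) := by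
  refine LipschitzWith.of_dist_le_mul fun a b => ?_
  refine (lipschitzWith_clamp01.dist_le_mul _ _).trans (le_of_eq ?_)
  rw [Real.dist_eq, Real.dist_eq, ← sub_div, sub_sub_sub_cancel_right, abs_div, NNReal.coe_one,
    one_mul, NNReal.abs_eq, NNReal.coe_inv, div_eq_inv_mul]

lemma lipConst_ramp_le {X : Type*} [MetricSpace X] {g : X → ℝ} {x : X} (hg : ContinuousAt g x)
    {h : ℝ≥0} (hh : 0 < h) (t : ℝ) :
    lipConst (fun y => clamp01 ((g y - t) / h)) x ≤
      (Icc (g x - h) (g x)).indicator (fun _ => (h : ℝ≥0∞)⁻¹ * lipConst g x) t := by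
  have hh' : (0 : ℝ) < h := hh
  by_cases ht : t ∈ Icc (g x - h) (g x)
  · rw [indicator_of_mem ht, ← ENNReal.coe_inv hh.ne']
    exact lipConst_comp_le (lipschitzWith_ramp h t) x
  rw [indicator_of_notMem ht]
  refine le_of_eq ?_
  rw [mem_Icc, not_and_or, not_le, not_le] at ht
  rcases ht with ht | ht
  · refine lipConst_eq_zero_of_eventuallyEq_const (c := 1) ?_
    filter_upwards [hg.eventually (lt_mem_nhds (show t + h < g x by linarith))] with y hy
    refine clamp01_of_one_le ?_
    rw [le_div_iff₀ hh']
    linarith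
  · refine lipConst_eq_zero_of_eventuallyEq_const (c := 0) ?_
    filter_upwards [hg.eventually (gt_mem_nhds ht)] with y hy
    exact clamp01_of_nonpos (div_nonpos_of_nonpos_of_nonneg (by linarith) hh'.le)

lemma lintegral_ramp_sub_le {h : ℝ≥0} (hh : 0 < h) (s s' : ℝ) :
    ∫⁻ t, ENNReal.ofReal |clamp01 ((s - t) / h) - (Iio s').indicator (fun _ => (1 : ℝ)) t| ≤
      ENNReal.ofReal |s - s'| + h := by
  have hh' : (0 : ℝ) < h := hh
  calc _ ≤ ∫⁻ t, (Icc (min (s - h) s') (max s s')).indicator 1 t := by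
        refine lintegral_mono fun t => ?_
        by_cases ht : t ∈ Icc (min (s - h) s') (max s s')
        · rw [indicator_of_mem ht, Pi.one_apply, ENNReal.ofReal_le_one]
          have h0 := clamp01_nonneg ((s - t) / h)
          have h1 := clamp01_le_one ((s - t) / h)
          by_cases h2 : t ∈ Iio s'
          · rw [indicator_of_mem h2, abs_le]; constructor <;> linarith
          · rw [indicator_of_notMem h2, abs_le]; constructor <;> linarith
        · rw [indicator_of_notMem ht]
          refine le_of_eq (ENNReal.ofReal_eq_zero.2 (le_of_eq (abs_eq_zero.2 ?_)))
          rw [mem_Icc, not_and_or, not_le, not_le, lt_min_iff, max_lt_iff] at ht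
          rcases ht with ⟨h1, h2⟩ | ⟨h1, h2⟩
          · rw [indicator_of_mem (show t ∈ Iio s' from h2), clamp01_of_one_le, sub_self]
            rw [le_div_iff₀ hh']
            linarith
          · rw [indicator_of_notMem (show t ∉ Iio s' from not_lt.2 h2.le), clamp01_of_nonpos,
              sub_self]
            exact div_nonpos_of_nonpos_of_nonneg (by linarith) hh'.le
    _ = ENNReal.ofReal (max s s' - min (s - h) s') := by
        rw [lintegral_indicator_one measurableSet_Icc, Real.volume_Icc]
    _ ≤ ENNReal.ofReal (|s - s'| + h) := by
        refine ENNReal.ofReal_le_ofReal ?_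
        have h1 : min s s' - h ≤ min (s - h) s' :=
          le_min (by linarith [min_le_left s s']) (by linarith [min_le_right s s'])
        linarith [max_sub_min_eq_abs' s s']
    _ = _ := by
        rw [ENNReal.ofReal_add (abs_nonneg _) hh'.le, ENNReal.ofReal_coe_nnreal]

end Ramp

section SlopeSlices

variable {X : Type*} [MeasurableSpace X]

lemma measurable_slice {g : X → ℝ} (hg : Measurable g) {ρ : X → ℝ≥0∞} (hρ : Measurable ρ)
    (h : ℝ≥0) : Measurable fun p : ℝ × X =>
      (Icc (g p.2 - h) (g p.2)).indicator (fun _ => (h : ℝ≥0∞)⁻¹ * ρ p.2) p.1 := by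
  have hs : MeasurableSet {p : ℝ × X | p.1 ∈ Icc (g p.2 - h) (g p.2)} :=
    (measurableSet_le (f := fun p : ℝ × X => g p.2 - h) (by fun_prop) measurable_fst).inter
      (measurableSet_le measurable_fst (by fun_prop))
  have : Measurable fun p : ℝ × X => (h : ℝ≥0∞)⁻¹ * ρ p.2 := by fun_prop
  exact this.indicator hs

lemma lintegral_slice {μ : Measure X} [SFinite μ] {g : X → ℝ} (hg : Measurable g)
    {ρ : X → ℝ≥0∞} (hρ : Measurable ρ) {h : ℝ≥0} (hh : 0 < h) :
    ∫⁻ t : ℝ, ∫⁻ x, (Icc (g x - h) (g x)).indicator (fun _ => (h : ℝ≥0∞)⁻¹ * ρ x) t ∂μ =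
      ∫⁻ x, ρ x ∂μ := by
  rw [lintegral_lintegral_swap (measurable_slice hg hρ h).aemeasurable]
  refine lintegral_congr fun x => ?_
  rw [lintegral_indicator_const measurableSet_Icc, Real.volume_Icc, sub_sub_cancel,
    ENNReal.ofReal_coe_nnreal, mul_right_comm,
    ENNReal.inv_mul_cancel (by simpa using hh.ne') ENNReal.coe_ne_top, one_mul]

end SlopeSlices

section Coarea

variable {X : Type*} [MetricSpace X] [MeasurableSpace X] [BorelSpace X]

lemma exists_measurable_approx_of_tvOpen_lt {μ : Measure X} {f : X → ℝ} {Ω : Set X}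
    (hΩ : IsOpen Ω) {a : ℝ≥0∞} (h : tvOpen μ f Ω < a) {K : Set X} (hK : IsCompact K)
    (hKΩ : K ⊆ Ω) {ε : ℝ≥0∞} (hε : 0 < ε) :
    ∃ g, Measurable g ∧ LocLipOn Ω g ∧ ∫⁻ x in K, ENNReal.ofReal |g x - f x| ∂μ ≤ ε ∧
      ∫⁻ x in Ω, lipConst g x ∂μ < a := by
  classical
  obtain ⟨g, h1, h2, h3⟩ := exists_approx_of_tvOpen_lt h hK hKΩ hε
  have heq : EqOn (Ω.indicator g) g Ω := fun x hx => indicator_of_mem hx g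
  refine ⟨Ω.indicator g, ?_, h1.congr heq, ?_, ?_⟩
  · rw [← piecewise_eq_indicator]
    exact h1.continuousOn.measurable_piecewise continuousOn_const hΩ.measurableSet
  · rwa [setLIntegral_congr_fun (g := fun x => ENNReal.ofReal |g x - f x|) hK.measurableSet
      fun x hx => by simp only [heq (hKΩ hx)]]
  · rwa [setLIntegral_congr_fun (g := lipConst g) hΩ.measurableSet
      fun x hx => lipConst_congr (heq.eventuallyEq_of_mem (hΩ.mem_nhds hx))]

/-- The inequality `∫ |D 1_{f > t}|(Ω) dt ≤ |Df|(Ω)` of the coarea formula. -/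
lemma exists_coarea_bound [ProperSpace X] {μ : Measure X} [IsLocallyFiniteMeasure μ] {f : X → ℝ}
    (hf : Measurable f) {Ω : Set X} (hΩ : IsOpen Ω) {a : ℝ≥0∞} (h : tvOpen μ f Ω < a) :
    ∃ D : ℝ → ℝ≥0∞, Measurable D ∧ ∫⁻ t, D t ≤ a ∧
      ∀ᵐ t, tvOpen μ ({x | t < f x}.indicator fun _ => (1 : ℝ)) Ω ≤ D t := by
  obtain ⟨K, hKc, hKΩ, hK⟩ := exists_exhaustion hΩ
  obtain ⟨ε, hε, hεsum⟩ := ENNReal.exists_pos_sum_of_countable' (one_ne_zero (α := ℝ≥0∞)) ℕ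
  choose g hgm hgL hgf hga using fun n =>
    exists_measurable_approx_of_tvOpen_lt hΩ h (hKc n) (hKΩ n) (hε n)
  choose η hη hηK using fun n =>
    ENNReal.exists_nnreal_pos_mul_lt ((hKc n).measure_lt_top (μ := μ)).ne (hε n).ne'
  let ρ : ℕ → X → ℝ≥0∞ := fun n => Ω.indicator (lipConst (g n))
  have hρ : ∀ n, Measurable (ρ n) := fun n => measurable_indicator_lipConst hΩ (hgL n).continuousOn
  let D : ℕ → ℝ → ℝ≥0∞ := fun n t => ∫⁻ x, (Icc (g n x - η n) (g n x)).indicator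
    (fun _ => (η n : ℝ≥0∞)⁻¹ * ρ n x) t ∂μ
  have hDm : ∀ n, Measurable (D n) := fun n =>
    (measurable_slice (hgm n) (hρ n) (η n)).lintegral_prod_right'
  let u : ℕ → ℝ → X → ℝ := fun n t x => clamp01 ((g n x - t) / η n)
  let I : ℕ → ℝ → ℝ≥0∞ := fun n t => ∫⁻ x in K n,
    ENNReal.ofReal |u n t x - {x | t < f x}.indicator (fun _ => (1 : ℝ)) x| ∂μ
  have hum : ∀ n, Measurable fun p : ℝ × X =>
      ENNReal.ofReal |u n p.1 p.2 - {x | p.1 < f x}.indicator (fun _ => (1 : ℝ)) p.2| := by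
    intro n
    have m1 : Measurable fun p : ℝ × X => u n p.1 p.2 :=
      lipschitzWith_clamp01.continuous.measurable.comp
        ((((hgm n).comp measurable_snd).sub measurable_fst).div_const _)
    have m2 : Measurable fun p : ℝ × X => {x | p.1 < f x}.indicator (fun _ => (1 : ℝ)) p.2 :=
      (measurable_const (a := (1 : ℝ))).indicator
        (measurableSet_lt measurable_fst (hf.comp measurable_snd))
    fun_prop
  have hIm : ∀ n, Measurable (I n) := fun n => (hum n).lintegral_prod_right'
  have hI : ∀ n, ∫⁻ t, I n t ≤ ε n + ε n := by
    intro n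
    rw [lintegral_lintegral_swap (hum n).aemeasurable]
    calc _ ≤ ∫⁻ x in K n, (ENNReal.ofReal |g n x - f x| + η n) ∂μ :=
          lintegral_mono fun x => lintegral_ramp_sub_le (hη n) (g n x) (f x)
      _ = ∫⁻ x in K n, ENNReal.ofReal |g n x - f x| ∂μ + η n * μ (K n) := by
          rw [lintegral_add_right _ measurable_const, setLIntegral_const]
      _ ≤ ε n + ε n := add_le_add (hgf n) (hηK n).le
  have hIfin : ∫⁻ t, ∑' n, I n t ≠ ⊤ := by
    rw [lintegral_tsum fun n => (hIm n).aemeasurable]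
    refine ne_top_of_le_ne_top ?_ (ENNReal.tsum_le_tsum hI)
    rw [ENNReal.tsum_add]
    exact ENNReal.add_ne_top.2 ⟨hεsum.ne_top, hεsum.ne_top⟩
  refine ⟨fun t => liminf (fun n => D n t) atTop, Measurable.liminf hDm, ?_, ?_⟩
  · refine (lintegral_liminf_le hDm).trans ?_
    refine (liminf_le_liminf (v := fun _ => a) (Eventually.of_forall fun n => ?_)).trans (by simp)
    dsimp only [D]
    rw [lintegral_slice (hgm n) (hρ n) (hη n), lintegral_indicator hΩ.measurableSet]
    exact (hga n).le
  · filter_upwards [ae_lt_top (Measurable.tsum hIm) hIfin] with t ht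
    refine (tvOpen_le_liminf (fn := fun n => u n t)
      (fun n => (hgL n).comp_lipschitz (lipschitzWith_ramp (η n) t))
      (tendstoL1loc_of_exhaustion hK (ENNReal.tendsto_atTop_zero_of_tsum_ne_top ht.ne)
        fun n => le_rfl)).trans (liminf_le_liminf (Eventually.of_forall fun n => ?_))
    dsimp only [D]
    rw [← lintegral_indicator hΩ.measurableSet]
    refine lintegral_mono fun x => ?_
    by_cases hx : x ∈ Ω
    · simp only [ρ, indicator_of_mem hx]
      exact lipConst_ramp_le ((hgL n).continuousOn.continuousAt (hΩ.mem_nhds hx)) (hη n) t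
    · simp [indicator_of_notMem hx]

end Coarea

section FinitePerimeter

variable {X : Type*} [MetricSpace X] [MeasurableSpace X]

lemma FinPerim.tvOpen_lt_top {μ : Measure X} {E : Set X} (hE : FinPerim μ E) :
    tvOpen μ (E.indicator fun _ => (1 : ℝ)) univ < ⊤ := by
  simpa only [perim, tv_univ] using hE.2

lemma finPerim_iff {μ : Measure X} {E : Set X} : FinPerim μ E ↔
    MeasurableSet E ∧ tvOpen μ (E.indicator fun _ => (1 : ℝ)) univ < ⊤ := by
  rw [FinPerim, perim, tv_univ]

lemma finPerim_empty (μ : Measure X) : FinPerim μ ∅ := by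
  refine finPerim_iff.2 ⟨.empty, ?_⟩
  rw [indicator_empty]
  refine lt_of_le_of_lt (tvOpen_le_of_forall_le (c := 0) (fn := fun _ _ => 0)
    (fun _ => LipschitzWith.locLipOn (LipschitzWith.const (0 : ℝ)) univ)
    (fun K _ _ => by simp) fun n => ?_)
    ENNReal.zero_lt_top
  simp [lipConst_eq_zero_of_eventuallyEq_const (EventuallyEq.refl _ (fun _ : X => (0 : ℝ)))]

lemma codimH_empty {μ : Measure X} (h : Prop12 μ) : codimH μ ∅ = 0 := by
  simpa [essBdry_empty] using h ∅ ∅ (finPerim_empty μ) (finPerim_empty μ) (disjoint_empty ∅)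

lemma FinPerim.compl {μ : Measure X} {E : Set X} (hE : FinPerim μ E) : FinPerim μ Eᶜ := by
  refine finPerim_iff.2 ⟨hE.1.compl, lt_of_le_of_lt ?_ hE.tvOpen_lt_top⟩
  have : (Eᶜ.indicator fun _ => (1 : ℝ)) = fun x => 1 - E.indicator (fun _ => (1 : ℝ)) x := by
    ext x
    by_cases hx : x ∈ E <;> simp [hx]
  rw [this]
  exact tvOpen_const_sub_le 1 _ univ

lemma FinPerim.inter [ProperSpace X] [BorelSpace X] {μ : Measure X} {E F : Set X}
    (hE : FinPerim μ E) (hF : FinPerim μ F) : FinPerim μ (E ∩ F) := by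
  refine finPerim_iff.2 ⟨hE.1.inter hF.1, lt_of_le_of_lt ?_
    (ENNReal.add_lt_top.2 ⟨hE.tvOpen_lt_top, hF.tvOpen_lt_top⟩)⟩
  have : ((E ∩ F).indicator fun _ => (1 : ℝ)) =
      fun x => min (E.indicator (fun _ => (1 : ℝ)) x) (F.indicator (fun _ => (1 : ℝ)) x) := by
    ext x
    by_cases hx : x ∈ E <;> by_cases hx' : x ∈ F <;> simp [hx, hx']
  rw [this]
  refine tvOpen_univ_le_add (measurable_const.indicator hE.1) min (fun a b c d => ?_)
    fun _ _ => LocLipOn.min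
  exact (abs_min_sub_min_le_max a b c d).trans
    (max_le_add_of_nonneg (abs_nonneg _) (abs_nonneg _))

lemma perim_union_le [ProperSpace X] [BorelSpace X] {μ : Measure X} {F G : Set X}
    (hF : MeasurableSet F) (hFG : Disjoint F G) :
    perim μ (F ∪ G) univ ≤ perim μ F univ + perim μ G univ := by
  simp only [perim, tv_univ]
  rw [indicator_union_of_disjoint hFG]
  refine tvOpen_univ_le_add (measurable_const.indicator hF) (· + ·) (fun a b c d => ?_)
    fun _ _ => LocLipOn.add
  rw [add_sub_add_comm]
  exact abs_add_le _ _

end FinitePerimeter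

section Isotropy

variable {X : Type*} [MetricSpace X] [MeasurableSpace X]

lemma codimH_union_le {μ : Measure X} (h0 : codimH μ ∅ = 0) (S T : Set X) :
    codimH μ (S ∪ T) ≤ codimH μ S + codimH μ T :=
  measure_union_le (μ := codimOuter μ h0) S T

lemma codimH_eq_zero_of_perim {μ : Measure X} {θ : Set X → X → ℝ≥0∞} (hθ : PerimRepr μ θ)
    {A B : Set X} (hA : FinPerim μ A) (hB : MeasurableSet B) (h : perim μ A B = 0) :
    codimH μ (B ∩ essBdry μ A) = 0 := by
  obtain ⟨γ, C, hγ, -, hr⟩ := hθ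
  obtain ⟨hbd, hrep⟩ := hr A hA
  rw [hrep B hB, outerLint] at h
  obtain ⟨c, hc0, hc⟩ := ENNReal.lt_iff_exists_nnreal_btwn.1 hγ
  have hle : codimH μ (B ∩ essBdry μ A) * ENNReal.ofReal c ≤ 0 := by
    rw [← h]
    calc _ = ∫⁻ _ in Ioc (0 : ℝ) c, codimH μ (B ∩ essBdry μ A) := by simp
      _ ≤ ∫⁻ t in Ioc (0 : ℝ) c,
          codimH μ {x ∈ B ∩ essBdry μ A | ENNReal.ofReal t < θ A x} := by
        refine setLIntegral_mono' measurableSet_Ioc fun t ht => codimH_mono fun x hx => ⟨hx, ?_⟩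
        refine lt_of_le_of_lt ?_ (hc.trans_le (hbd x hx.2).1)
        rw [← ENNReal.ofReal_coe_nnreal]
        exact ENNReal.ofReal_le_ofReal ht.2
      _ ≤ _ := lintegral_mono_set Ioc_subset_Ioi_self
  rw [ENNReal.ofReal_coe_nnreal, nonpos_iff_eq_zero, mul_eq_zero] at hle
  exact hle.resolve_right hc0.ne'

lemma perim_le_lintegral_codimH {μ : Measure X} {θ : Set X → X → ℝ≥0∞} (hθ : PerimRepr μ θ)
    (h0 : codimH μ ∅ = 0) {E F : Set X} (hF : FinPerim μ F)
    (hdiff : codimH μ (essBdry μ F \ essBdry μ E) = 0)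
    (hiso : codimH μ {x ∈ essBdry μ F ∩ essBdry μ E | θ F x ≠ θ E x} = 0) :
    perim μ F univ ≤ ∫⁻ t in Ioi (0 : ℝ),
      codimH μ ({x ∈ essBdry μ E | ENNReal.ofReal t < θ E x} ∩ essBdry μ F) := by
  obtain ⟨_, _, -, -, hr⟩ := hθ
  rw [(hr F hF).2 univ .univ, outerLint]
  refine lintegral_mono fun t => ?_
  refine (codimH_mono (T := ({x ∈ essBdry μ E | ENNReal.ofReal t < θ E x} ∩ essBdry μ F) ∪
    ((essBdry μ F \ essBdry μ E) ∪ {x ∈ essBdry μ F ∩ essBdry μ E | θ F x ≠ θ E x})) ?_).trans ?_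
  · rintro x ⟨⟨-, hxF⟩, hxt⟩
    by_cases hxE : x ∈ essBdry μ E
    · by_cases hxθ : θ F x = θ E x
      · exact Or.inl ⟨⟨hxE, hxθ ▸ hxt⟩, hxF⟩
      · exact Or.inr (Or.inr ⟨⟨hxF, hxE⟩, hxθ⟩)
    · exact Or.inr (Or.inl ⟨hxF, hxE⟩)
  · refine (codimH_union_le h0 _ _).trans ?_
    refine (add_le_add_right (codimH_union_le h0 _ _) _).trans ?_
    rw [hdiff, hiso, add_zero, add_zero]

/-- In an isotropic space with property (1.2), cutting `E` along a set without perimeter in the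
essential interior of `E` does not create perimeter. -/
lemma perim_inter_add_perim_diff_le [TopologicalSpace.SeparableSpace X] [ProperSpace X]
    [BorelSpace X] {μ : Measure X} [IsLocallyFiniteMeasure μ] {C : ℝ≥0} (hD : Doubling μ C)
    (hμ : μ ≠ 0) (hiso : Isotropic μ) (h12 : Prop12 μ) {E A B : Set X} (hE : FinPerim μ E)
    (hA : FinPerim μ A) (hB : MeasurableSet B) (hEB : essInt μ E ⊆ B) (hAB : perim μ A B = 0) :
    perim μ (E ∩ A) univ + perim μ (E ∩ Aᶜ) univ ≤ perim μ E univ := by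
  obtain ⟨θ, hθ, hθiso⟩ := hiso
  have h0 := codimH_empty h12
  have hF := hE.inter hA
  have hG := hE.inter hA.compl
  have hnull : codimH μ (essInt μ E ∩ essBdry μ A) = 0 :=
    le_antisymm ((codimH_mono (inter_subset_inter_left _ hEB)).trans
      (codimH_eq_zero_of_perim hθ hA hB hAB).le) zero_le
  have hFd : codimH μ (essBdry μ (E ∩ A) \ essBdry μ E) = 0 :=
    le_antisymm ((codimH_mono (essBdry_inter_diff_subset hD hμ hE.1 A)).trans hnull.le) zero_le
  have hGd : codimH μ (essBdry μ (E ∩ Aᶜ) \ essBdry μ E) = 0 := by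
    have := essBdry_inter_diff_subset hD hμ hE.1 Aᶜ
    rw [essBdry_compl] at this
    exact le_antisymm ((codimH_mono this).trans hnull.le) zero_le
  have h12' : codimH μ (essBdry μ (E ∩ A) ∩ essBdry μ (E ∩ Aᶜ) ∩ essBdry μ E) = 0 := by
    have := h12 _ _ hF hG ((disjoint_compl_right).mono inter_subset_right inter_subset_right)
    rwa [inter_union_compl] at this
  have hEm : perim μ E univ = ∫⁻ t in Ioi (0 : ℝ),
      codimH μ {x ∈ essBdry μ E | ENNReal.ofReal t < θ E x} := by
    obtain ⟨_, _, -, -, hr⟩ := hθ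
    rw [(hr E hE).2 univ .univ, outerLint, univ_inter]
  have hanti : Antitone fun t : ℝ =>
      codimH μ ({x ∈ essBdry μ E | ENNReal.ofReal t < θ E x} ∩ essBdry μ (E ∩ A)) :=
    fun s t hst => codimH_mono (inter_subset_inter_left _ fun x hx =>
      ⟨hx.1, (ENNReal.ofReal_le_ofReal hst).trans_lt hx.2⟩)
  refine (add_le_add
    (perim_le_lintegral_codimH hθ h0 hF hFd (hθiso E _ hE hF inter_subset_left))
    (perim_le_lintegral_codimH hθ h0 hG hGd (hθiso E _ hE hG inter_subset_left))).trans ?_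
  rw [← lintegral_add_left hanti.measurable, hEm]
  refine lintegral_mono fun t => ?_
  set L := {x ∈ essBdry μ E | ENNReal.ofReal t < θ E x}
  rw [← codimH_inter_add_diff h0 L (measurableSet_essBdry hD hμ hF.1)]
  gcongr
  refine (codimH_mono (T := (L \ essBdry μ (E ∩ A)) ∪
    (essBdry μ (E ∩ A) ∩ essBdry μ (E ∩ Aᶜ) ∩ essBdry μ E)) ?_).trans
    ((codimH_union_le h0 _ _).trans (by rw [h12', add_zero]))
  rintro x ⟨hxL, hxG⟩
  by_cases hxF : x ∈ essBdry μ (E ∩ A)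
  · exact Or.inr ⟨⟨hxF, hxG⟩, hxL.1⟩
  · exact Or.inl ⟨hxL, hxF⟩

/-- Cuts of an indecomposable set along a set without perimeter in its essential interior
are trivial. -/
lemma Indecomposable.measure_inter_eq_zero_or [TopologicalSpace.SeparableSpace X] [ProperSpace X]
    [BorelSpace X] {μ : Measure X} [IsLocallyFiniteMeasure μ] {C : ℝ≥0} (hD : Doubling μ C)
    (hμ : μ ≠ 0) (hiso : Isotropic μ) (h12 : Prop12 μ) {E A B : Set X} (hE : Indecomposable μ E)
    (hA : FinPerim μ A) (hB : MeasurableSet B) (hEB : essInt μ E ⊆ B) (hAB : perim μ A B = 0) :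
    μ (E ∩ A) = 0 ∨ μ (E ∩ Aᶜ) = 0 := by
  by_contra! hne
  have hdisj : Disjoint (E ∩ A) (E ∩ Aᶜ) :=
    disjoint_compl_right.mono inter_subset_right inter_subset_right
  refine hE.2 ⟨E ∩ A, E ∩ Aᶜ, hE.1.inter hA, hE.1.inter hA.compl, hdisj, ?_,
    pos_iff_ne_zero.2 hne.1, pos_iff_ne_zero.2 hne.2, le_antisymm ?_
    (perim_inter_add_perim_diff_le hD hμ hiso h12 hE.1 hA hB hEB hAB)⟩
  · rw [inter_union_compl, inter_univ]
  · simpa only [inter_union_compl] using perim_union_le (μ := μ) (hE.1.1.inter hA.1) hdisj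

end Isotropy

section Constancy

lemma ae_const_of_ae_superlevel {X : Type*} [MeasurableSpace X] {μ : Measure X} {f : X → ℝ}
    (h : ∀ᵐ t : ℝ, (∀ᵐ x ∂μ, t < f x) ∨ ∀ᵐ x ∂μ, ¬ t < f x) : ∃ c, ∀ᵐ x ∂μ, f x = c := by
  have hdense : ∀ t, ∃ s : ℕ → ℝ, (∀ n, t < s n ∧ ((∀ᵐ x ∂μ, s n < f x) ∨
      ∀ᵐ x ∂μ, ¬ s n < f x)) ∧ Tendsto s atTop (𝓝 t) := by
    intro t
    have : ∀ n : ℕ, ∃ s, s ∈ Ioo t (t + 1 / ((n : ℝ) + 1)) ∧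
        ((∀ᵐ x ∂μ, s < f x) ∨ ∀ᵐ x ∂μ, ¬ s < f x) := fun n => by
      obtain ⟨s, hs1, hs2⟩ := (Measure.dense_of_ae h).exists_mem_open
        (isOpen_Ioo (a := t) (b := t + 1 / ((n : ℝ) + 1)))
        (nonempty_Ioo.2 (lt_add_of_pos_right _ (by positivity)))
      exact ⟨s, hs2, hs1⟩
    choose s hs1 hs2 using this
    refine ⟨s, fun n => ⟨(hs1 n).1, hs2 n⟩, ?_⟩
    have hlim := (tendsto_one_div_add_atTop_nhds_zero_nat (𝕜 := ℝ)).const_add t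
    rw [add_zero] at hlim
    exact tendsto_of_tendsto_of_tendsto_of_le_of_le tendsto_const_nhds hlim
      (fun n => (hs1 n).1.le) fun n => (hs1 n).2.le
  refine exists_eventuallyEq_const_of_forall_separating (l := ae μ) (f := f)
    (· ∈ range (Ioi : ℝ → Set ℝ)) ?_
  rintro _ ⟨t, rfl⟩
  obtain ⟨s, hs, hlim⟩ := hdense t
  by_cases hex : ∃ n, ∀ᵐ x ∂μ, s n < f x
  · obtain ⟨n, hn⟩ := hex
    exact Or.inl (hn.mono fun x hx => (hs n).1.trans hx)
  · rw [not_exists] at hex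
    have hall := ae_all_iff.2 fun n => (hs n).2.resolve_left (hex n)
    exact Or.inr (hall.mono fun x hx =>
      not_lt.2 (ge_of_tendsto' hlim fun n => not_lt.1 (hx n)))

variable {X : Type*} [MetricSpace X] [MeasurableSpace X] [BorelSpace X]

/-- Almost all superlevel sets of a function of finite variation have finite perimeter, and no
perimeter where the function has no variation. -/
lemma ae_finPerim_superlevel [ProperSpace X] {μ : Measure X} [IsLocallyFiniteMeasure μ]
    {f : X → ℝ} (hf : Measurable f) (hfin : tv μ f univ < ⊤) {S : Set X} (hS : tv μ f S = 0) :
    ∃ B, MeasurableSet B ∧ S ⊆ B ∧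
      ∀ᵐ t : ℝ, FinPerim μ {x | t < f x} ∧ perim μ {x | t < f x} B = 0 := by
  rw [tv_univ] at hfin
  obtain ⟨D, hDm, hDint, hD⟩ := exists_coarea_bound hf isOpen_univ
    (ENNReal.lt_add_right hfin.ne one_ne_zero)
  obtain ⟨ε, hε, hεsum⟩ := ENNReal.exists_pos_sum_of_countable' (one_ne_zero (α := ℝ≥0∞)) ℕ
  have hex : ∀ k, ∃ Ω, IsOpen Ω ∧ S ⊆ Ω ∧ tvOpen μ f Ω < ε k := fun k => by
    have : tv μ f S < ε k := hS ▸ hε k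
    simpa only [tv, iInf_lt_iff, exists_prop] using this
  choose Ω hΩ hSΩ hΩε using hex
  choose Dk hDkm hDkint hDk using fun k => exists_coarea_bound hf (hΩ k) (hΩε k)
  refine ⟨⋂ k, Ω k, .iInter fun k => (hΩ k).measurableSet, subset_iInter hSΩ, ?_⟩
  have hsum : ∫⁻ t, ∑' k, Dk k t ≠ ⊤ := by
    rw [lintegral_tsum fun k => (hDkm k).aemeasurable]
    exact ne_top_of_le_ne_top hεsum.ne_top (ENNReal.tsum_le_tsum hDkint)
  filter_upwards [hD, ae_lt_top hDm (ne_top_of_le_ne_top (by finiteness) hDint),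
    ae_all_iff.2 hDk, ae_lt_top (Measurable.tsum hDkm) hsum] with t h1 h2 h3 h4
  refine ⟨finPerim_iff.2 ⟨measurableSet_lt measurable_const hf, h1.trans_lt h2⟩, ?_⟩
  refine le_antisymm (ge_of_tendsto' (ENNReal.tendsto_atTop_zero_of_tsum_ne_top h4.ne)
    fun k => ?_) zero_le
  exact (tv_le_tvOpen (hΩ k) (iInter_subset Ω k)).trans (h3 k)

/-- In an isotropic PI space with property (1.2), a function without variation in the essential
interior of an indecomposable set is constant on that set. -/
lemma Indecomposable.exists_ae_const [CompleteSpace X] [TopologicalSpace.SeparableSpace X]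
    {μ : Measure X} [IsLocallyFiniteMeasure μ] (hμ : μ ≠ 0) (hPI : IsPI μ) (hiso : Isotropic μ)
    (h12 : Prop12 μ) {E : Set X} (hE : Indecomposable μ E) {f : X → ℝ}
    (hf : LocallyIntegrable f μ) (hfin : tv μ f univ < ⊤) (hf0 : tv μ f (essInt μ E) = 0) :
    ∃ t : ℝ, ∀ᵐ x ∂(μ.restrict E), f x = t := by
  obtain ⟨C, CP, lam, hD, -, -, -⟩ := hPI
  have := hD.properSpace hμ
  have : SecondCountableTopology X := UniformSpace.secondCountable_of_separable X
  have hae := hf.aestronglyMeasurable.aemeasurable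
  rw [tv_congr hae.ae_eq_mk] at hfin hf0
  obtain ⟨B, hB, hEB, hlev⟩ := ae_finPerim_superlevel hae.measurable_mk hfin hf0
  obtain ⟨c, hc⟩ := ae_const_of_ae_superlevel (μ := μ.restrict E) (f := hae.mk f) (by
    filter_upwards [hlev] with t ht
    rcases hE.measure_inter_eq_zero_or hD hμ hiso h12 ht.1 hB hEB ht.2 with h | h
    · right
      rw [ae_restrict_iff' hE.1.1]
      exact measure_mono_null (fun x hx => by simpa using hx) h
    · left
      rw [ae_restrict_iff' hE.1.1]
      exact measure_mono_null (fun x hx => by simpa using hx) h)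
  refine ⟨c, ?_⟩
  filter_upwards [ae_restrict_of_ae hae.ae_eq_mk, hc] with x hx hxc using hx.trans hxc

end Constancy

variable {X : Type*} [MetricSpace X] [CompleteSpace X] [TopologicalSpace.SeparableSpace X]
  [MeasurableSpace X] [BorelSpace X]

/-- Characterisation of indecomposable sets. -/
theorem indecomposable_characterisation
    (μ : Measure X) [IsLocallyFiniteMeasure μ] (hμ : μ ≠ 0) (hPI : IsPI μ) :
    (∀ E : Set X, FinPerim μ E →
      (∀ f : X → ℝ, MeasureTheory.LocallyIntegrable f μ → tv μ f Set.univ < ⊤ →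
        tv μ f (essInt μ E) = 0 →
          ∃ t : ℝ, ∀ᵐ x ∂(μ.restrict E), f x = t) →
      Indecomposable μ E) ∧
    (Isotropic μ → Prop12 μ →
      ∀ E : Set X, Indecomposable μ E →
        ∀ f : X → ℝ, MeasureTheory.LocallyIntegrable f μ → tv μ f Set.univ < ⊤ →
          tv μ f (essInt μ E) = 0 →
            ∃ t : ℝ, ∀ᵐ x ∂(μ.restrict E), f x = t) := by
  exact ⟨fun _ hE h => indecomposable_of_forall_const hμ hPI hE h,
    fun hiso h12 _ hE _ hf hfin hf0 => hE.exists_ae_const hμ hPI hiso h12 hf hfin hf0⟩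

end PaperBV
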